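/- arXiv:gr-qc/0004008 — 2 statements merged into one kernel-verified Lean document; each statement's English description precedes it below -/
import Mathlib

section
/- (Explicit partie-finie integral.) Let y₁ ≠ y₂ in ℝ³, r₁₂ = |y₁ − y₂|, and s₁, s₂ > 0. Then lim_{s→0⁺} [ ∫_{ℝ³∖(B̄(y₁,s) ∪ B̄(y₂,s))} d³x/(r₁³ r₂³ (r₁ + r₂)) + (4π/r₁₂⁴) ln(s/s₁) + (4π/r₁₂⁴) ln(s/s₂) ] exists and equals (4π/r₁₂⁴) [ ln(r₁₂/s₁) + ln(r₁₂/s₂) − (8/3) ln 2 + 2/3 ]. -/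
open MeasureTheory Filter Topology Real Asymptotics

noncomputable section

abbrev E3 : Type := EuclideanSpace ℝ (Fin 3)
abbrev S2 : Type := Metric.sphere (0 : E3) 1

/-- The surface measure `dΩ` on the unit sphere `S²` (total mass `4π`). -/
def dOmega : Measure S2 := (volume : Measure E3).toSphere

/-- A function on the unit sphere is smooth iff it is the restriction of
a smooth function on `ℝ³`. -/
def SmoothSphereFn (f : S2 → ℝ) : Prop :=
  ∃ g : E3 → ℝ, ContDiff ℝ (⊤ : ℕ∞) g ∧ ∀ n : S2, g (n : E3) = f n

/-- `F` admits a power-like singular expansion at `y` with coefficients `c`: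
the family of exponents (the `a`'s with `c a ≠ 0`) is bounded below, with only
finitely many exponents below any given bound, the coefficients are smooth
functions on the sphere, and for every `N`, `F(y + r n) = Σ_{a ≤ N} r^a (c a)(n)
+ o(r^N)` as `r → 0⁺`, uniformly in `n ∈ S²`. -/
structure HasSingExpansion (y : E3) (F : E3 → ℝ) (c : ℝ → S2 → ℝ) : Prop where
  smooth_coeffs : ∀ a : ℝ, SmoothSphereFn (c a)
  bddBelow : ∃ a₀ : ℝ, ∀ a : ℝ, a < a₀ → c a = 0
  finite_exponents : ∀ N : ℝ, {a : ℝ | a ≤ N ∧ c a ≠ 0}.Finite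
  expansion : ∀ N : ℕ, ∀ ε > 0, ∃ δ > 0, ∀ r : ℝ, 0 < r → r < δ → ∀ n : S2,
    |F (y + r • (n : E3)) - ∑ᶠ (a : ℝ) (_ : a ≤ (N : ℝ)), r ^ a * c a n| ≤ ε * r ^ (N : ℝ)

/-- The exponents of the singular expansion are integers. -/
def IntegerExponents (c : ℝ → S2 → ℝ) : Prop :=
  ∀ a : ℝ, c a ≠ 0 → ∃ k : ℤ, a = (k : ℝ)

/-- The Hadamard partie finie at the singular point, `(F)_y = (1/4π) ∫_{S²} f₀ dΩ`,
expressed in terms of the expansion coefficients `c` of `F`. -/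
def pfAt (c : ℝ → S2 → ℝ) : ℝ :=
  (4 * π)⁻¹ * ∫ n : S2, c 0 n ∂dOmega

/-- `F` is smooth on a punctured neighbourhood of `y`. -/
def SmoothNearPunctured (y : E3) (F : E3 → ℝ) : Prop :=
  ∃ U ∈ 𝓝 y, ContDiffOn ℝ (⊤ : ℕ∞) F (U \ {y})

/-- The quantity whose limit as `s → 0⁺` defines the Hadamard partie finie
`Pf_{s₁,s₂} ∫ F d³x`: the integral over `ℝ³` minus two balls of radius `s`,
plus the divergent subtractions built from the expansion coefficients `c` at `y₁`
and `d` at `y₂`. -/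
def pfApprox (y₁ y₂ : E3) (s₁ s₂ : ℝ) (F : E3 → ℝ) (c d : ℝ → S2 → ℝ) (s : ℝ) : ℝ :=
  (∫ x in (Metric.closedBall y₁ s ∪ Metric.closedBall y₂ s)ᶜ, F x)
    + (∑ᶠ (a : ℝ) (_ : a < -3), s ^ (a + 3) / (a + 3) * ∫ n : S2, c a n ∂dOmega)
    + Real.log (s / s₁) * (∫ n : S2, c (-3) n ∂dOmega)
    + (∑ᶠ (b : ℝ) (_ : b < -3), s ^ (b + 3) / (b + 3) * ∫ n : S2, d b n ∂dOmega)
    + Real.log (s / s₂) * (∫ n : S2, d (-3) n ∂dOmega)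

/-- `Pf_{s₁,s₂} ∫ F d³x` exists and equals `L`. -/
def HasPfIntegral (y₁ y₂ : E3) (s₁ s₂ : ℝ) (F : E3 → ℝ) (c d : ℝ → S2 → ℝ) (L : ℝ) : Prop :=
  Tendsto (pfApprox y₁ y₂ s₁ s₂ F c d) (𝓝[>] (0 : ℝ)) (𝓝 L)

/-- Membership in the class `𝓕`: smooth outside `{y₁, y₂}` and admitting singular
expansions at `y₁` (coefficients `c`) and `y₂` (coefficients `d`). -/
structure MemF (y₁ y₂ : E3) (F : E3 → ℝ) (c d : ℝ → S2 → ℝ) : Prop where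
  smooth : ContDiffOn ℝ (⊤ : ℕ∞) F ({y₁, y₂}ᶜ : Set E3)
  exp₁ : HasSingExpansion y₁ F c
  exp₂ : HasSingExpansion y₂ F d

/-- The partial derivative `∂_i F` (as a plain function, defined outside the
singularities via `fderiv`). -/
def pder (i : Fin 3) (F : E3 → ℝ) (x : E3) : ℝ :=
  fderiv ℝ F x (EuclideanSpace.single i 1)

/-! ## Geometry: reduction to bipolar coordinates -/

lemma mp_toE3 : MeasurePreserving
    (fun q : ℝ × ℝ × ℝ => (WithLp.toLp 2 ![q.1, q.2.1, q.2.2] : E3)) volume volume := by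
  have h1 : MeasurePreserving (MeasurableEquiv.finTwoArrow (α := ℝ)).symm volume volume :=
    (volume_preserving_finTwoArrow ℝ).symm _
  have h2 : MeasurePreserving (Prod.map (id : ℝ → ℝ) (MeasurableEquiv.finTwoArrow (α := ℝ)).symm)
      (volume : Measure (ℝ × ℝ × ℝ)) volume := (MeasurePreserving.id volume).prod h1
  have h3 : MeasurePreserving (MeasurableEquiv.piFinSuccAbove (fun _ : Fin 3 => ℝ) 0).symm
      volume volume := (volume_preserving_piFinSuccAbove (fun _ : Fin 3 => ℝ) 0).symm _
  have h4 := (PiLp.volume_preserving_toLp (Fin 3)).comp (h3.comp h2)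
  have h5 : (fun q : ℝ × ℝ × ℝ => (WithLp.toLp 2 ![q.1, q.2.1, q.2.2] : E3)) =
      WithLp.toLp 2 ∘ (MeasurableEquiv.piFinSuccAbove (fun _ : Fin 3 => ℝ) 0).symm ∘
        Prod.map (id : ℝ → ℝ) (MeasurableEquiv.finTwoArrow (α := ℝ)).symm := by
    funext q
    simp only [Function.comp]
    congr 1
    funext i
    fin_cases i <;> rfl
  rw [h5]
  exact h4

lemma lintegral_E3 (y₁ y₂ : E3) (hy : y₁ ≠ y₂) (F : ℝ × ℝ → ENNReal) (hF : Measurable F) :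
    ∫⁻ x : E3, F (‖x - y₁‖, ‖x - y₂‖) =
    ∫⁻ q : ℝ × ℝ × ℝ, F (√((q.1 + ‖y₁ - y₂‖ / 2) ^ 2 + (q.2.1 ^ 2 + q.2.2 ^ 2)),
      √((q.1 - ‖y₁ - y₂‖ / 2) ^ 2 + (q.2.1 ^ 2 + q.2.2 ^ 2))) := by
  set d := ‖y₁ - y₂‖ with hd
  have hd0 : 0 < d := norm_pos_iff.2 (sub_ne_zero.2 hy)
  obtain ⟨b, hb⟩ := Orthonormal.exists_orthonormalBasis_extension_of_card_eq (𝕜 := ℝ) (E := E3)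
    (ι := Fin 3) (by simp) (v := fun _ => d⁻¹ • (y₂ - y₁)) (s := {0}) (by
      rw [orthonormal_iff_ite]
      rintro ⟨i, hi⟩ ⟨j, hj⟩
      have hi' : i = 0 := hi
      have hj' : j = 0 := hj
      subst hi' hj'
      have hn : ‖d⁻¹ • (y₂ - y₁)‖ = 1 := by
        rw [norm_smul, norm_sub_rev, ← hd, norm_inv, Real.norm_of_nonneg hd0.le,
          inv_mul_cancel₀ hd0.ne']
      simp only [Set.domRestrict, real_inner_self_eq_norm_sq, hn]
      simp)
  have hb0 : d⁻¹ • (y₂ - y₁) = b 0 := (hb 0 rfl).symm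
  have hT : MeasurePreserving (fun q : ℝ × ℝ × ℝ => (2⁻¹ : ℝ) • (y₁ + y₂) +
      b.repr.symm (WithLp.toLp 2 ![q.1, q.2.1, q.2.2] : E3)) volume volume :=
    (measurePreserving_add_left volume ((2⁻¹ : ℝ) • (y₁ + y₂))).comp
      (b.measurePreserving_repr_symm.comp mp_toE3)
  rw [← hT.lintegral_comp (by fun_prop)]
  have hdiff : y₂ - y₁ = d • b 0 := by rw [← hb0, smul_smul, mul_inv_cancel₀ hd0.ne', one_smul]
  have key : ∀ (q : ℝ × ℝ × ℝ) (t : ℝ), ‖b.repr.symm (WithLp.toLp 2 ![q.1, q.2.1, q.2.2] : E3)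
      + t • b 0‖ = √((q.1 + t) ^ 2 + (q.2.1 ^ 2 + q.2.2 ^ 2)) := by
    intro q t
    have : b 0 = b.repr.symm (EuclideanSpace.single 0 1) := by simp
    rw [this, ← map_smul, ← map_add, LinearIsometryEquiv.norm_map, EuclideanSpace.norm_eq]
    congr 1
    simp [Fin.sum_univ_three]
    ring
  congr 1
  funext q
  have e1 : (2⁻¹ : ℝ) • (y₁ + y₂) + b.repr.symm (WithLp.toLp 2 ![q.1, q.2.1, q.2.2] : E3) - y₁
      = b.repr.symm (WithLp.toLp 2 ![q.1, q.2.1, q.2.2] : E3) + (d / 2) • b 0 := by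
    have : (d / 2) • b 0 = (2⁻¹ : ℝ) • (y₂ - y₁) := by rw [hdiff, smul_smul]; congr 1; ring
    rw [this]; module
  have e2 : (2⁻¹ : ℝ) • (y₁ + y₂) + b.repr.symm (WithLp.toLp 2 ![q.1, q.2.1, q.2.2] : E3) - y₂
      = b.repr.symm (WithLp.toLp 2 ![q.1, q.2.1, q.2.2] : E3) + (-(d / 2)) • b 0 := by
    have : (-(d / 2)) • b 0 = -((2⁻¹ : ℝ) • (y₂ - y₁)) := by
      rw [hdiff, smul_smul, neg_smul]; congr 2; ring
    rw [this]; module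
  rw [e1, e2, key, key, ← sub_eq_add_neg]

/-- Integration of a radial function on the plane. -/
lemma lintegral_radial (g : ℝ → ENNReal) (hg : Measurable g) :
    ∫⁻ p : ℝ × ℝ, g (p.1 ^ 2 + p.2 ^ 2) =
      ENNReal.ofReal (2 * π) * ∫⁻ r in Set.Ioi (0 : ℝ), ENNReal.ofReal r * g (r ^ 2) := by
  rw [← lintegral_comp_polarCoord_symm]
  have : ∀ p : ℝ × ℝ, ENNReal.ofReal p.1 • g ((polarCoord.symm p).1 ^ 2 + (polarCoord.symm p).2 ^ 2)
      = ENNReal.ofReal p.1 * g (p.1 ^ 2) := by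
    intro p
    simp only [polarCoord_symm_apply, smul_eq_mul]
    congr 2
    have := Real.sin_sq_add_cos_sq p.2
    linear_combination p.1 ^ 2 * this
  simp_rw [this]
  rw [polarCoord_target, Measure.volume_eq_prod, ← Measure.prod_restrict,
    lintegral_prod _ (by fun_prop)]
  simp only [lintegral_const, Measure.restrict_apply MeasurableSet.univ, Set.univ_inter,
    Real.volume_Ioo]
  rw [lintegral_mul_const _ (by fun_prop), mul_comm]
  congr 2
  ring

/-- The inverse bipolar (prolate spheroidal) map. -/
def bip (c : ℝ) (p : ℝ × ℝ) : ℝ × ℝ :=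
  (p.1 * p.2 / c, √((p.1 ^ 2 - c ^ 2) * (c ^ 2 - p.2 ^ 2)) / c)

def bipD (c : ℝ) (p : ℝ × ℝ) : ℝ × ℝ →L[ℝ] ℝ × ℝ :=
  LinearMap.toContinuousLinearMap (Matrix.toLin (Module.Basis.finTwoProd ℝ) (Module.Basis.finTwoProd ℝ)
    !![p.2 / c, p.1 / c;
       p.1 * (c ^ 2 - p.2 ^ 2) / (c * √((p.1 ^ 2 - c ^ 2) * (c ^ 2 - p.2 ^ 2))),
       - p.2 * (p.1 ^ 2 - c ^ 2) / (c * √((p.1 ^ 2 - c ^ 2) * (c ^ 2 - p.2 ^ 2)))])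

lemma bip_pos {c : ℝ} (hc : 0 < c) {p : ℝ × ℝ} (hp : p ∈ Set.Ioi c ×ˢ Set.Ioo (-c) c) :
    0 < p.1 ^ 2 - c ^ 2 ∧ 0 < c ^ 2 - p.2 ^ 2 := by
  obtain ⟨h1, h2, h3⟩ := hp
  simp only [Set.mem_Ioi] at h1
  constructor <;> nlinarith

lemma bip_hasFDerivAt {c : ℝ} (hc : 0 < c) {p : ℝ × ℝ} (hp : p ∈ Set.Ioi c ×ˢ Set.Ioo (-c) c) :
    HasFDerivAt (bip c) (bipD c p) p := by
  obtain ⟨h1, h2⟩ := bip_pos hc hp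
  have hR : 0 < (p.1 ^ 2 - c ^ 2) * (c ^ 2 - p.2 ^ 2) := mul_pos h1 h2
  have hf : HasFDerivAt (fun p : ℝ × ℝ => p.1) (ContinuousLinearMap.fst ℝ ℝ ℝ) p := hasFDerivAt_fst
  have hs : HasFDerivAt (fun p : ℝ × ℝ => p.2) (ContinuousLinearMap.snd ℝ ℝ ℝ) p := hasFDerivAt_snd
  have ha := (hf.mul hs).mul_const c⁻¹
  have hb := (((((hf.pow 2).sub_const (c ^ 2)).mul ((hs.pow 2).const_sub (c ^ 2))).sqrt
    hR.ne').mul_const c⁻¹)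
  have := ha.prodMk hb
  have hsq := Real.sqrt_pos.2 hR
  refine (this.congr_fderiv ?_).congr_of_eventuallyEq ?_
  · apply ContinuousLinearMap.ext
    intro w
    simp only [bipD, Matrix.toLin_finTwoProd_toContinuousLinearMap]
    ext
    · simp; field_simp; ring
    · simp; field_simp; ring
  · exact Filter.Eventually.of_forall fun q => by simp [bip, div_eq_mul_inv]

lemma bipD_det {c : ℝ} (hc : 0 < c) {p : ℝ × ℝ} (hp : p ∈ Set.Ioi c ×ˢ Set.Ioo (-c) c) :
    |(bipD c p).det| = (p.1 ^ 2 - p.2 ^ 2) / √((p.1 ^ 2 - c ^ 2) * (c ^ 2 - p.2 ^ 2)) := by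
  obtain ⟨h1, h2⟩ := bip_pos hc hp
  have hR : 0 < (p.1 ^ 2 - c ^ 2) * (c ^ 2 - p.2 ^ 2) := mul_pos h1 h2
  have hsq := Real.sqrt_pos.2 hR
  have : (bipD c p).det =
      -((p.1 ^ 2 - p.2 ^ 2) / √((p.1 ^ 2 - c ^ 2) * (c ^ 2 - p.2 ^ 2))) := by
    rw [bipD, LinearMap.det_toContinuousLinearMap, LinearMap.det_toLin, Matrix.det_fin_two_of]
    field_simp
    ring
  rw [this, abs_neg, abs_of_nonneg]
  apply div_nonneg _ hsq.le
  linarith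

lemma bip_sqrt_add {c : ℝ} (hc : 0 < c) {p : ℝ × ℝ} (hp : p ∈ Set.Ioi c ×ˢ Set.Ioo (-c) c) :
    √(((bip c p).1 + c) ^ 2 + (bip c p).2 ^ 2) = p.1 + p.2 := by
  obtain ⟨h1, h2⟩ := bip_pos hc hp
  have hR : 0 < (p.1 ^ 2 - c ^ 2) * (c ^ 2 - p.2 ^ 2) := mul_pos h1 h2
  obtain ⟨h3, h4, h5⟩ := hp
  simp only [Set.mem_Ioi] at h3
  rw [Real.sqrt_eq_iff_mul_self_eq_of_pos (by linarith)]
  simp only [bip, div_pow, Real.sq_sqrt hR.le]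
  field_simp
  ring

lemma bip_sqrt_sub {c : ℝ} (hc : 0 < c) {p : ℝ × ℝ} (hp : p ∈ Set.Ioi c ×ˢ Set.Ioo (-c) c) :
    √(((bip c p).1 - c) ^ 2 + (bip c p).2 ^ 2) = p.1 - p.2 := by
  obtain ⟨h1, h2⟩ := bip_pos hc hp
  have hR : 0 < (p.1 ^ 2 - c ^ 2) * (c ^ 2 - p.2 ^ 2) := mul_pos h1 h2
  obtain ⟨h3, h4, h5⟩ := hp
  simp only [Set.mem_Ioi] at h3
  rw [Real.sqrt_eq_iff_mul_self_eq_of_pos (by linarith)]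
  simp only [bip, div_pow, Real.sq_sqrt hR.le]
  field_simp
  ring

lemma bip_injOn {c : ℝ} (hc : 0 < c) : Set.InjOn (bip c) (Set.Ioi c ×ˢ Set.Ioo (-c) c) := by
  intro p hp q hq h
  have a1 := bip_sqrt_add hc hp
  have a2 := bip_sqrt_sub hc hp
  rw [h] at a1 a2
  rw [bip_sqrt_add hc hq] at a1
  rw [bip_sqrt_sub hc hq] at a2
  ext <;> linarith

lemma bip_image {c : ℝ} (hc : 0 < c) :
    Set.image (bip c) (Set.Ioi c ×ˢ Set.Ioo (-c) c) = Set.univ ×ˢ Set.Ioi 0 := by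
  ext ⟨z, ρ⟩
  constructor
  · rintro ⟨p, hp, h⟩
    obtain ⟨h1, h2⟩ := bip_pos hc hp
    have hR : 0 < (p.1 ^ 2 - c ^ 2) * (c ^ 2 - p.2 ^ 2) := mul_pos h1 h2
    refine ⟨trivial, ?_⟩
    rw [← h]
    exact div_pos (Real.sqrt_pos.2 hR) hc
  · rintro ⟨-, hρ⟩
    simp only [Set.mem_Ioi] at hρ
    have ha : 0 < (z + c) ^ 2 + ρ ^ 2 := by positivity
    have hb : 0 < (z - c) ^ 2 + ρ ^ 2 := by positivity
    set a := √((z + c) ^ 2 + ρ ^ 2) with ha'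
    set b := √((z - c) ^ 2 + ρ ^ 2) with hb'
    have ha2 : a ^ 2 = (z + c) ^ 2 + ρ ^ 2 := Real.sq_sqrt ha.le
    have hb2 : b ^ 2 = (z - c) ^ 2 + ρ ^ 2 := Real.sq_sqrt hb.le
    have ha0 : 0 < a := Real.sqrt_pos.2 ha
    have hb0 : 0 < b := Real.sqrt_pos.2 hb
    have huv : (a + b) / 2 * ((a - b) / 2) = z * c := by nlinarith
    have hR : (((a + b) / 2) ^ 2 - c ^ 2) * (c ^ 2 - ((a - b) / 2) ^ 2) = (c * ρ) ^ 2 := by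
      have : ((a + b) / 2) ^ 2 + ((a - b) / 2) ^ 2 = z ^ 2 + c ^ 2 + ρ ^ 2 := by nlinarith
      linear_combination c ^ 2 * this - ((a + b) / 2 * ((a - b) / 2) + z * c) * huv
    have hRpos : 0 < (c * ρ) ^ 2 := by positivity
    have hle : ((a - b) / 2) ^ 2 ≤ ((a + b) / 2) ^ 2 := by nlinarith
    have hA : 0 < ((a + b) / 2) ^ 2 - c ^ 2 := by
      by_contra hcon
      have h2 : 0 ≤ c ^ 2 - ((a - b) / 2) ^ 2 := by linarith
      nlinarith
    have hB : 0 < c ^ 2 - ((a - b) / 2) ^ 2 := by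
      rw [← hR] at hRpos
      exact (pos_iff_pos_of_mul_pos hRpos).1 hA
    refine ⟨((a + b) / 2, (a - b) / 2), ⟨?_, ?_⟩, ?_⟩
    · exact lt_of_pow_lt_pow_left₀ (a := c) (b := (a + b) / 2) 2 (by positivity) (by linarith)
    · exact abs_lt.1 (abs_lt_of_sq_lt_sq (by linarith) hc.le)
    · simp only [bip, hR, huv]
      rw [Real.sqrt_sq (by positivity)]
      ext
      · simp; field_simp
      · simp; field_simp

/-- Reduction of a two-centre integral to bipolar coordinates. -/
lemma lintegral_bipolar (y₁ y₂ : E3) (hy : y₁ ≠ y₂) (F : ℝ × ℝ → ENNReal) (hF : Measurable F)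
    (c : ℝ) (hcd : c = ‖y₁ - y₂‖ / 2) :
    ∫⁻ x : E3, F (‖x - y₁‖, ‖x - y₂‖) =
      ENNReal.ofReal (2 * π) * ∫⁻ u in Set.Ioi c, ∫⁻ v in Set.Ioo (-c) c,
        ENNReal.ofReal ((u ^ 2 - v ^ 2) / c) * F (u + v, u - v) := by
  have hc : 0 < c := by rw [hcd]; exact half_pos (norm_pos_iff.2 (sub_ne_zero.2 hy))
  rw [lintegral_E3 y₁ y₂ hy F hF, ← hcd, Measure.volume_eq_prod, lintegral_prod _ (by fun_prop)]
  have h1 : ∀ z : ℝ, ∫⁻ p : ℝ × ℝ, F (√((z + c) ^ 2 + (p.1 ^ 2 + p.2 ^ 2)),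
      √((z - c) ^ 2 + (p.1 ^ 2 + p.2 ^ 2))) = ENNReal.ofReal (2 * π) *
      ∫⁻ r in Set.Ioi (0 : ℝ), ENNReal.ofReal r * F (√((z + c) ^ 2 + r ^ 2),
        √((z - c) ^ 2 + r ^ 2)) := fun z =>
    lintegral_radial (fun t => F (√((z + c) ^ 2 + t), √((z - c) ^ 2 + t))) (by fun_prop)
  simp only [h1]
  rw [lintegral_const_mul _ (Measurable.lintegral_prod_right' (ν := volume.restrict (Set.Ioi (0:ℝ)))
    (f := fun q : ℝ × ℝ => ENNReal.ofReal q.2 * F (√((q.1 + c) ^ 2 + q.2 ^ 2),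
        √((q.1 - c) ^ 2 + q.2 ^ 2))) (by fun_prop))]
  congr 1
  have h2 := lintegral_prod (μ := (volume : Measure ℝ)) (ν := volume.restrict (Set.Ioi (0:ℝ)))
    (fun q : ℝ × ℝ => ENNReal.ofReal q.2 * F (√((q.1 + c) ^ 2 + q.2 ^ 2),
        √((q.1 - c) ^ 2 + q.2 ^ 2))) (by fun_prop)
  rw [← h2]
  have h3 : (volume : Measure ℝ).prod (volume.restrict (Set.Ioi (0:ℝ))) =
      (volume : Measure (ℝ × ℝ)).restrict (Set.univ ×ˢ Set.Ioi (0:ℝ)) := by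
    rw [Measure.volume_eq_prod, ← Measure.prod_restrict, Measure.restrict_univ]
  rw [h3, ← bip_image hc, lintegral_image_eq_lintegral_abs_det_fderiv_mul volume
    (measurableSet_Ioi.prod measurableSet_Ioo)
    (fun p hp => (bip_hasFDerivAt hc hp).hasFDerivWithinAt) (bip_injOn hc)]
  have h4 := lintegral_prod (μ := volume.restrict (Set.Ioi c)) (ν := volume.restrict (Set.Ioo (-c) c))
    (fun q : ℝ × ℝ => ENNReal.ofReal ((q.1 ^ 2 - q.2 ^ 2) / c) * F (q.1 + q.2, q.1 - q.2))
    (by fun_prop)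
  rw [← h4, Measure.prod_restrict, ← Measure.volume_eq_prod]
  apply setLIntegral_congr_fun (measurableSet_Ioi.prod measurableSet_Ioo)
  intro p hp
  have hR : 0 < (p.1 ^ 2 - c ^ 2) * (c ^ 2 - p.2 ^ 2) :=
    mul_pos (bip_pos hc hp).1 (bip_pos hc hp).2
  have hsq := Real.sqrt_pos.2 hR
  simp only
  rw [bipD_det hc hp, bip_sqrt_add hc hp, bip_sqrt_sub hc hp, ← mul_assoc,
    ← ENNReal.ofReal_mul' (by simp only [bip]; positivity)]
  congr 2
  simp only [bip]
  field_simp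

/-! ## One-dimensional integrals -/

/-- antiderivative in `v` of `1/(u²-v²)²`. -/
def KK (u v : ℝ) : ℝ :=
  v / (2 * u ^ 2 * (u ^ 2 - v ^ 2)) + (Real.log (u + v) - Real.log (u - v)) / (4 * u ^ 3)

lemma KK_hasDerivAt {u v : ℝ} (h1 : 0 < u + v) (h2 : 0 < u - v) :
    HasDerivAt (fun v => KK u v) (1 / (u ^ 2 - v ^ 2) ^ 2) v := by
  have hu : 0 < u := by linarith
  have h3 : 0 < u ^ 2 - v ^ 2 := by nlinarith
  have hid := hasDerivAt_id v
  have a1 := hid.div (((hid.pow 2).const_sub (u ^ 2)).const_mul (2 * u ^ 2))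
    (by simp only [id, Pi.pow_apply]; positivity)
  have a2 := (((hid.const_add u).log h1.ne').sub ((hid.const_sub u).log h2.ne')).div_const
    (4 * u ^ 3)
  refine HasDerivAt.congr_deriv (f := fun v => KK u v) (a1.add a2) ?_
  simp only [id, Pi.pow_apply]
  have e : u ^ 2 - v ^ 2 = (u + v) * (u - v) := by ring
  rw [e]
  field_simp
  ring

lemma KK_neg (u v : ℝ) : KK u (-v) = - KK u v := by
  unfold KK
  rw [neg_sq, sub_neg_eq_add, ← sub_eq_add_neg]
  ring

lemma KK_nonneg {u v : ℝ} (h0 : 0 ≤ v) (h : v < u) : 0 ≤ KK u v := by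
  have h3 : 0 < u ^ 2 - v ^ 2 := by nlinarith
  have hu : 0 < u := by linarith
  have : Real.log (u - v) ≤ Real.log (u + v) := Real.log_le_log (by linarith) (by linarith)
  unfold KK
  have : 0 ≤ Real.log (u + v) - Real.log (u - v) := by linarith
  positivity

/-- the integrand as a function of the two distances, with cutoff -/
def FF (s : ℝ) (p : ℝ × ℝ) : ENNReal :=
  Set.indicator {p : ℝ × ℝ | s < p.1 ∧ s < p.2}
    (fun p => ENNReal.ofReal (1 / (p.1 ^ 3 * p.2 ^ 3 * (p.1 + p.2)))) p

lemma FF_measurable (s : ℝ) : Measurable (FF s) := by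
  unfold FF
  apply Measurable.indicator (by fun_prop)
  exact (measurableSet_lt measurable_const measurable_fst).inter
    (measurableSet_lt measurable_const measurable_snd)

lemma inner_integral {c s u : ℝ} (hs : 0 < s) (hsc : s < c) (hu : c < u) :
    ∫⁻ v in Set.Ioo (-c) c, ENNReal.ofReal ((u ^ 2 - v ^ 2) / c) * FF s (u + v, u - v) =
      ENNReal.ofReal (KK u (min c (u - s)) / (c * u)) := by
  set m := min c (u - s) with hm
  have hc : 0 < c := hs.trans hsc
  have hm0 : 0 < m := lt_min hc (by linarith)
  have hmu : m < u := (min_le_right _ _).trans_lt (by linarith)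
  have hmc : m ≤ c := min_le_left _ _
  have hms : m ≤ u - s := min_le_right _ _
  have hset : ∀ v ∈ Set.Ioo (-c) c, ENNReal.ofReal ((u ^ 2 - v ^ 2) / c) * FF s (u + v, u - v) =
      Set.indicator (Set.Ioo (-m) m)
        (fun v => ENNReal.ofReal (1 / (u ^ 2 - v ^ 2) ^ 2 / (2 * c * u))) v := by
    intro v hv
    by_cases hvm : v ∈ Set.Ioo (-m) m
    · have h1 : 0 < u + v := by linarith [hvm.1]
      have h2 : 0 < u - v := by linarith [hvm.2]
      have hu0 : 0 < u := by linarith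
      rw [Set.indicator_of_mem hvm, FF, Set.indicator_of_mem (by
        constructor <;> simp only <;> linarith [hvm.1, hvm.2])]
      have e : u ^ 2 - v ^ 2 = (u + v) * (u - v) := by ring
      rw [← ENNReal.ofReal_mul (by rw [e]; positivity)]
      congr 1
      simp only
      rw [e]
      field_simp
      ring
    · rw [Set.indicator_of_notMem hvm, FF, Set.indicator_of_notMem, mul_zero]
      rintro ⟨h1, h2⟩
      simp only at h1 h2
      exact hvm ⟨by
        have : -v < m := lt_min (by linarith [hv.1]) (by linarith)
        linarith, lt_min hv.2 (by linarith)⟩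
  rw [setLIntegral_congr_fun measurableSet_Ioo hset, lintegral_indicator measurableSet_Ioo,
    Measure.restrict_restrict measurableSet_Ioo,
    Set.inter_eq_left.2 (Set.Ioo_subset_Ioo (by linarith) hmc)]
  have hpos : ∀ v ∈ Set.Icc (-m) m, 0 < u ^ 2 - v ^ 2 := by
    intro v hv
    nlinarith [hv.1, hv.2]
  have hcont : ContinuousOn (fun v => 1 / (u ^ 2 - v ^ 2) ^ 2 / (2 * c * u)) (Set.Icc (-m) m) := by
    apply ContinuousOn.div_const
    apply ContinuousOn.div continuousOn_const (by fun_prop)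
    intro v hv
    exact (pow_pos (hpos v hv) 2).ne'
  have hint : IntegrableOn (fun v => 1 / (u ^ 2 - v ^ 2) ^ 2 / (2 * c * u)) (Set.Icc (-m) m) :=
    hcont.integrableOn_Icc
  rw [← ofReal_integral_eq_lintegral_ofReal (hint.mono_set Set.Ioo_subset_Icc_self)]
  · congr 1
    rw [← integral_Ioc_eq_integral_Ioo, ← intervalIntegral.integral_of_le (by linarith),
      intervalIntegral.integral_eq_sub_of_hasDerivAt (f := fun v => KK u v / (2 * c * u))]
    · simp only [KK_neg]
      field_simp
      ring
    · intro v hv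
      rw [Set.uIcc_of_le (by linarith)] at hv
      exact (KK_hasDerivAt (by linarith [hv.1]) (by linarith [hv.2])).div_const _
    · rw [intervalIntegrable_iff_integrableOn_Icc_of_le (by linarith)]
      exact hint
  · have : 0 < u := by linarith
    exact Filter.Eventually.of_forall fun v => by simp only [Pi.zero_apply]; positivity

/-- antiderivative in `u` of `KK u c / (c u)`. -/
def GG (c u : ℝ) : ℝ :=
  -(Real.log (u + c) - Real.log (u - c)) / (12 * c * u ^ 3) +
    (1 / (2 * c ^ 2 * u ^ 2) +
      ((Real.log (u + c) - Real.log u) + (Real.log (u - c) - Real.log u)) / (2 * c ^ 4)) / 3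

lemma GG_hasDerivAt {c u : ℝ} (hc : 0 < c) (hu : c < u) :
    HasDerivAt (fun u => GG c u) (KK u c / (c * u)) u := by
  have h0 : 0 < u := hc.trans hu
  have h1 : 0 < u + c := by linarith
  have h2 : 0 < u - c := by linarith
  have hid := hasDerivAt_id u
  have l1 := (hid.add_const c).log h1.ne'
  have l2 := (hid.sub_const c).log h2.ne'
  have l3 := hid.log h0.ne'
  have a1 := (l1.sub l2).neg.div ((hid.pow 3).const_mul (12 * c))
    (by simp only [id, Pi.pow_apply]; positivity)
  have a2 := (hasDerivAt_const u (1:ℝ)).div ((hid.pow 2).const_mul (2 * c ^ 2))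
    (by simp only [id, Pi.pow_apply]; positivity)
  have a3 := ((l1.sub l3).add (l2.sub l3)).div_const (2 * c ^ 4)
  refine HasDerivAt.congr_deriv (f := fun u => GG c u) (a1.add ((a2.add a3).div_const 3)) ?_
  simp only [id, Pi.pow_apply, Pi.sub_apply, Pi.neg_apply, KK]
  have e : u ^ 2 - c ^ 2 = (u + c) * (u - c) := by ring
  rw [e]
  generalize Real.log (u + c) = A
  generalize Real.log (u - c) = B
  field_simp
  ring

lemma GG_tendsto {c : ℝ} (hc : 0 < c) : Tendsto (fun u => GG c u) atTop (𝓝 0) := by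
  have t1 := Real.tendsto_log_comp_add_sub_log c
  have t2 := Real.tendsto_log_comp_add_sub_log (-c)
  simp only [← sub_eq_add_neg] at t2
  have t3 : Tendsto (fun u : ℝ => 1 / u) atTop (𝓝 0) := by
    simpa using tendsto_inv_atTop_zero (𝕜 := ℝ)
  have := (((t2.sub t1).mul (t3.pow 3)).div_const (12 * c)).add
    ((((t3.pow 2).div_const (2 * c ^ 2)).add ((t1.add t2).div_const (2 * c ^ 4))).div_const 3)
  simp only [sub_zero, add_zero, zero_div, ne_eq, OfNat.ofNat_ne_zero, not_false_eq_true, zero_pow,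
    mul_zero] at this
  refine this.congr' ?_
  filter_upwards [eventually_gt_atTop 0] with u hu
  unfold GG
  field_simp
  ring

def BB (c s : ℝ) : ℝ := ∫ u in c..(c + s), KK u (u - s) / (c * u)

lemma BB_cont {c s : ℝ} (hs : 0 < s) (hsc : s < c) :
    ContinuousOn (fun u => KK u (u - s) / (c * u)) (Set.Icc c (c + s)) := by
  have hc : 0 < c := hs.trans hsc
  have hp : ∀ u ∈ Set.Icc c (c + s), 0 < u := fun u hu => hc.trans_le hu.1
  have h1 : ∀ u ∈ Set.Icc c (c + s), 0 < u ^ 2 - (u - s) ^ 2 := fun u hu => by nlinarith [hu.1]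
  unfold KK
  refine ContinuousOn.div (ContinuousOn.add (ContinuousOn.div (by fun_prop) (by fun_prop) ?_)
    (ContinuousOn.div (ContinuousOn.sub (ContinuousOn.log (by fun_prop) ?_)
      (ContinuousOn.log (by fun_prop) ?_)) (by fun_prop) ?_)) (by fun_prop) ?_
  · intro u hu
    have := hp u hu
    have := h1 u hu
    positivity
  · intro u hu
    have := hu.1
    have : 0 < u + (u - s) := by linarith
    exact this.ne'
  · intro u hu
    simp [hs.ne']
  · intro u hu
    have := hp u hu
    positivity
  · intro u hu
    have := hp u hu
    positivity

lemma outer_integral {c s : ℝ} (hs : 0 < s) (hsc : s < c) :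
    ∫⁻ u in Set.Ioi c, ENNReal.ofReal (KK u (min c (u - s)) / (c * u)) =
      ENNReal.ofReal (BB c s - GG c (c + s)) ∧ 0 ≤ BB c s - GG c (c + s) := by
  have hc : 0 < c := hs.trans hsc
  have hsplit : Set.Ioi c = Set.Ioc c (c + s) ∪ Set.Ioi (c + s) :=
    (Set.Ioc_union_Ioi_eq_Ioi (by linarith)).symm
  have hB0 : ∀ u ∈ Set.Ioc c (c + s), 0 ≤ KK u (u - s) / (c * u) := by
    intro u hu
    have := hu.1
    have h0 : 0 < u := hc.trans this
    have := KK_nonneg (u := u) (v := u - s) (by linarith) (by linarith)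
    positivity
  have hG0 : ∀ u ∈ Set.Ioi (c + s), 0 ≤ KK u c / (c * u) := by
    intro u hu
    have : c + s < u := hu
    have h0 : 0 < u := by linarith
    have := KK_nonneg (u := u) (v := c) hc.le (by linarith)
    positivity
  have hGd : ∀ u ∈ Set.Ici (c + s), HasDerivAt (fun u => GG c u) (KK u c / (c * u)) u := by
    intro u hu
    have : c + s ≤ u := hu
    exact GG_hasDerivAt hc (by linarith)
  have hint : IntegrableOn (fun u => KK u (u - s) / (c * u)) (Set.Ioc c (c + s)) :=
    (BB_cont hs hsc).integrableOn_Icc.mono_set Set.Ioc_subset_Icc_self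
  have e1 : ∫⁻ u in Set.Ioc c (c + s), ENNReal.ofReal (KK u (min c (u - s)) / (c * u)) =
      ENNReal.ofReal (BB c s) := by
    rw [BB, intervalIntegral.integral_of_le (by linarith), ofReal_integral_eq_lintegral_ofReal hint
      ((ae_restrict_iff' measurableSet_Ioc).2 (Filter.Eventually.of_forall hB0))]
    apply setLIntegral_congr_fun measurableSet_Ioc
    intro u hu
    have := hu.2
    simp only
    rw [min_eq_right (by linarith)]
  have hGint := integrableOn_Ioi_deriv_of_nonneg' hGd hG0 (GG_tendsto hc)
  have hGval := integral_Ioi_of_hasDerivAt_of_nonneg' hGd hG0 (GG_tendsto hc)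
  have e2 : ∫⁻ u in Set.Ioi (c + s), ENNReal.ofReal (KK u (min c (u - s)) / (c * u)) =
      ENNReal.ofReal (0 - GG c (c + s)) := by
    rw [← hGval, ofReal_integral_eq_lintegral_ofReal hGint
      ((ae_restrict_iff' measurableSet_Ioi).2 (Filter.Eventually.of_forall hG0))]
    apply setLIntegral_congr_fun measurableSet_Ioi
    intro u hu
    have : c + s < u := hu
    simp only
    rw [min_eq_left (by linarith)]
  have n1 : 0 ≤ BB c s := by
    rw [BB, intervalIntegral.integral_of_le (by linarith)]
    exact setIntegral_nonneg measurableSet_Ioc hB0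
  have n2 : 0 ≤ 0 - GG c (c + s) := by
    rw [← hGval]
    exact setIntegral_nonneg measurableSet_Ioi hG0
  refine ⟨?_, by linarith⟩
  rw [hsplit, lintegral_union measurableSet_Ioi (by
    rw [Set.disjoint_left]
    intro x hx hx'
    exact absurd hx.2 (not_le.2 hx')), e1, e2, ← ENNReal.ofReal_add n1 n2]
  congr 1
  ring

lemma integral_value (y₁ y₂ : E3) (hy : y₁ ≠ y₂) (c s : ℝ) (hcd : c = ‖y₁ - y₂‖ / 2)
    (hs : 0 < s) (hsc : s < c) :
    ∫ x in (Metric.closedBall y₁ s ∪ Metric.closedBall y₂ s)ᶜ,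
      1 / (‖x - y₁‖ ^ 3 * ‖x - y₂‖ ^ 3 * (‖x - y₁‖ + ‖x - y₂‖)) =
    2 * π * (BB c s - GG c (c + s)) := by
  have hms : MeasurableSet (Metric.closedBall y₁ s ∪ Metric.closedBall y₂ s)ᶜ :=
    (measurableSet_closedBall.union measurableSet_closedBall).compl
  rw [integral_eq_lintegral_of_nonneg_ae
    (Filter.Eventually.of_forall fun x => by simp only [Pi.zero_apply]; positivity)
    (Measurable.aestronglyMeasurable (by fun_prop)), ← lintegral_indicator hms]
  have h1 : ∀ x : E3, (Metric.closedBall y₁ s ∪ Metric.closedBall y₂ s)ᶜ.indicator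
      (fun x => ENNReal.ofReal (1 / (‖x - y₁‖ ^ 3 * ‖x - y₂‖ ^ 3 * (‖x - y₁‖ + ‖x - y₂‖)))) x =
      FF s (‖x - y₁‖, ‖x - y₂‖) := by
    intro x
    have hiff : x ∈ (Metric.closedBall y₁ s ∪ Metric.closedBall y₂ s)ᶜ ↔
        (‖x - y₁‖, ‖x - y₂‖) ∈ {p : ℝ × ℝ | s < p.1 ∧ s < p.2} := by
      simp [dist_eq_norm]
    by_cases hx : x ∈ (Metric.closedBall y₁ s ∪ Metric.closedBall y₂ s)ᶜ
    · rw [Set.indicator_of_mem hx, FF, Set.indicator_of_mem (hiff.1 hx)]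
    · rw [Set.indicator_of_notMem hx, FF, Set.indicator_of_notMem (fun h => hx (hiff.2 h))]
  simp only [h1]
  rw [lintegral_bipolar y₁ y₂ hy (FF s) (FF_measurable s) c hcd,
    setLIntegral_congr_fun measurableSet_Ioi (fun u hu => inner_integral hs hsc hu),
    (outer_integral hs hsc).1, ← ENNReal.ofReal_mul (by positivity), ENNReal.toReal_ofReal]
  exact mul_nonneg (by positivity) (outer_integral hs hsc).2

/-! ## Limits -/

lemma tendsto_of_cont {f : ℝ → ℝ} {l : ℝ} (hf : ContinuousAt f 0) (h : f 0 = l) :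
    Tendsto f (𝓝[>] 0) (𝓝 l) := h ▸ hf.tendsto.mono_left nhdsWithin_le_nhds

lemma tendsto_mul_log : Tendsto (fun s : ℝ => s * Real.log s) (𝓝[>] 0) (𝓝 0) :=
  tendsto_of_cont Real.continuous_mul_log.continuousAt (by simp)

lemma BB_tendsto {c : ℝ} (hc : 0 < c) : Tendsto (fun s => BB c s) (𝓝[>] 0) (𝓝 (1 / (4 * c ^ 4))) := by
  have hlo : Tendsto (fun s : ℝ => (c - s) / (2 * c * (c + s) ^ 3 * (2 * c + s))) (𝓝[>] 0)
      (𝓝 (1 / (4 * c ^ 4))) := by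
    apply tendsto_of_cont
    · apply ContinuousAt.div (by fun_prop) (by fun_prop)
      simp only [add_zero]; positivity
    · simp only [add_zero, sub_zero]; field_simp; norm_num
  have hhi : Tendsto (fun s : ℝ => 1 / (2 * c ^ 3 * (2 * c - s)) +
      (s * Real.log (2 * c + s) - s * Real.log s) / (4 * c ^ 5)) (𝓝[>] 0)
      (𝓝 (1 / (4 * c ^ 4) + (0 - 0) / (4 * c ^ 5))) := by
    apply Tendsto.add
    · apply tendsto_of_cont
      · apply ContinuousAt.div (by fun_prop) (by fun_prop)
        simp only [sub_zero]; positivity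
      · simp only [sub_zero]; field_simp; norm_num
    · apply Tendsto.div_const
      apply Tendsto.sub _ tendsto_mul_log
      apply tendsto_of_cont
      · apply ContinuousAt.mul (by fun_prop) (ContinuousAt.log (by fun_prop) _)
        simp only [add_zero]; positivity
      · simp
  simp only [sub_zero, zero_div, add_zero] at hhi
  have hev : ∀ᶠ s : ℝ in 𝓝[>] 0, 0 < s ∧ s < c ∧ s < 1 / 2 * c := by
    filter_upwards [Ioo_mem_nhdsGT (show (0:ℝ) < 1 / 2 * c by positivity)] with s hs
    exact ⟨hs.1, by linarith [hs.2], hs.2⟩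
  have hterm : ∀ s : ℝ, 0 < s → s < c → ∀ u ∈ Set.Icc c (c + s),
      (c - s) / (2 * c * (c + s) ^ 3 * (2 * c + s)) / s ≤ KK u (u - s) / (c * u) ∧
      KK u (u - s) / (c * u) ≤ (1 / (2 * c ^ 3 * (2 * c - s)) +
      (s * Real.log (2 * c + s) - s * Real.log s) / (4 * c ^ 5)) / s := by
    intro s hs hsc u hu
    obtain ⟨h1, h2⟩ := hu
    have hu0 : 0 < u := hc.trans_le h1
    have hus : 0 < 2 * u - s := by linarith
    have hcs : 0 < 2 * c - s := by linarith
    have heq : KK u (u - s) / (c * u) = (u - s) / (2 * c * u ^ 3 * (2 * u - s)) / s +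
        (Real.log (2 * u - s) - Real.log s) / (4 * c * u ^ 4) := by
      unfold KK
      have e1 : u ^ 2 - (u - s) ^ 2 = s * (2 * u - s) := by ring
      have e2 : u + (u - s) = 2 * u - s := by ring
      have e3 : u - (u - s) = s := by ring
      rw [e1, e2, e3]
      field_simp
    have hl1 : Real.log s ≤ Real.log (2 * u - s) := Real.log_le_log hs (by linarith)
    have hl2 : Real.log (2 * u - s) ≤ Real.log (2 * c + s) := Real.log_le_log hus (by linarith)
    have hl0 : 0 ≤ Real.log (2 * u - s) - Real.log s := by linarith
    rw [heq]
    constructor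
    · have : (c - s) / (2 * c * (c + s) ^ 3 * (2 * c + s)) / s ≤
          (u - s) / (2 * c * u ^ 3 * (2 * u - s)) / s := by
        gcongr
        · linarith
        · linarith
      have : 0 ≤ (Real.log (2 * u - s) - Real.log s) / (4 * c * u ^ 4) := by positivity
      linarith
    · have i1 : (u - s) / (2 * c * u ^ 3 * (2 * u - s)) ≤ 1 / (2 * c ^ 3 * (2 * c - s)) := by
        calc (u - s) / (2 * c * u ^ 3 * (2 * u - s)) ≤ u / (2 * c * u ^ 3 * (2 * u - s)) := by
              gcongr; linarith
          _ = 1 / (2 * c * u ^ 2 * (2 * u - s)) := by field_simp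
          _ ≤ 1 / (2 * c * c ^ 2 * (2 * c - s)) := by gcongr
          _ = 1 / (2 * c ^ 3 * (2 * c - s)) := by congr 1; ring
      have i2 : (Real.log (2 * u - s) - Real.log s) / (4 * c * u ^ 4) ≤
          (Real.log (2 * c + s) - Real.log s) / (4 * c * c ^ 4) := by
        have : 0 ≤ Real.log (2 * c + s) - Real.log s := by linarith
        gcongr
      have i3 : (1 / (2 * c ^ 3 * (2 * c - s)) +
          (s * Real.log (2 * c + s) - s * Real.log s) / (4 * c ^ 5)) / s =
          1 / (2 * c ^ 3 * (2 * c - s)) / s +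
          (Real.log (2 * c + s) - Real.log s) / (4 * c * c ^ 4) := by
        field_simp
      rw [i3]
      gcongr
  refine tendsto_of_tendsto_of_tendsto_of_le_of_le' hlo hhi ?_ ?_
  · filter_upwards [hev] with s ⟨hs, hsc, _⟩
    have hi : IntervalIntegrable (fun u => KK u (u - s) / (c * u)) volume c (c + s) := by
      apply ContinuousOn.intervalIntegrable_of_Icc (by linarith) (BB_cont hs hsc)
    have := intervalIntegral.integral_mono_on (a := c) (b := c + s) (by linarith)
      intervalIntegrable_const hi (fun u hu => (hterm s hs hsc u hu).1)
    rw [intervalIntegral.integral_const, smul_eq_mul, add_sub_cancel_left,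
      mul_div_cancel₀ _ hs.ne'] at this
    exact this
  · filter_upwards [hev] with s ⟨hs, hsc, _⟩
    have hi : IntervalIntegrable (fun u => KK u (u - s) / (c * u)) volume c (c + s) := by
      apply ContinuousOn.intervalIntegrable_of_Icc (by linarith) (BB_cont hs hsc)
    have := intervalIntegral.integral_mono_on (a := c) (b := c + s) (by linarith)
      hi intervalIntegrable_const (fun u hu => (hterm s hs hsc u hu).2)
    rw [intervalIntegral.integral_const, smul_eq_mul, add_sub_cancel_left,
      mul_div_cancel₀ _ hs.ne'] at this
    exact this

lemma GG_lim {c : ℝ} (hc : 0 < c) :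
    Tendsto (fun s => GG c (c + s) - Real.log s / (4 * c ^ 4)) (𝓝[>] 0)
      (𝓝 (-(Real.log (2 * c)) / (12 * c ^ 4) + (1 / (2 * c ^ 4) +
        (Real.log (2 * c) - 2 * Real.log c) / (2 * c ^ 4)) / 3)) := by
  have t1 : Tendsto (fun s : ℝ => -(Real.log (2 * c + s)) / (12 * c * (c + s) ^ 3) +
      (1 / (2 * c ^ 2 * (c + s) ^ 2) +
        (Real.log (2 * c + s) - 2 * Real.log (c + s)) / (2 * c ^ 4)) / 3) (𝓝[>] 0)
      (𝓝 (-(Real.log (2 * c)) / (12 * c ^ 4) + (1 / (2 * c ^ 4) +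
        (Real.log (2 * c) - 2 * Real.log c) / (2 * c ^ 4)) / 3)) := by
    apply tendsto_of_cont
    · have l1 : ContinuousAt (fun s : ℝ => Real.log (2 * c + s)) 0 :=
        ContinuousAt.log (by fun_prop) (by simp only [add_zero]; positivity)
      have l2 : ContinuousAt (fun s : ℝ => Real.log (c + s)) 0 :=
        ContinuousAt.log (by fun_prop) (by simp only [add_zero]; positivity)
      refine ContinuousAt.add (ContinuousAt.div l1.neg (by fun_prop) ?_)
        (ContinuousAt.div_const (ContinuousAt.add (ContinuousAt.div (by fun_prop) (by fun_prop) ?_)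
          (ContinuousAt.div_const (l1.sub (l2.const_mul 2)) _)) _)
      · simp only [add_zero]; positivity
      · simp only [add_zero]; positivity
    · simp only [add_zero]
      congr 2
      · ring
      · congr 2; ring
  have t2 : Tendsto (fun s : ℝ => s * Real.log s *
      (-(3 * c ^ 2 + 3 * c * s + s ^ 2) / (12 * c ^ 4 * (c + s) ^ 3))) (𝓝[>] 0)
      (𝓝 (0 * (-(3 * c ^ 2) / (12 * c ^ 4 * c ^ 3)))) := by
    apply tendsto_mul_log.mul
    apply tendsto_of_cont
    · apply ContinuousAt.div (by fun_prop) (by fun_prop)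
      simp only [add_zero]; positivity
    · simp
  have t3 := t1.add t2
  rw [zero_mul, add_zero] at t3
  refine t3.congr' ?_
  filter_upwards [self_mem_nhdsWithin] with s hs
  have hs0 : 0 < s := hs
  unfold GG
  have e1 : c + s + c = 2 * c + s := by ring
  have e2 : c + s - c = s := by ring
  rw [e1, e2]
  generalize Real.log (2 * c + s) = A
  generalize Real.log (c + s) = B
  generalize Real.log s = L
  field_simp
  ring

/-- explicit partie-finie integral:
`Pf_{s₁,s₂} ∫ d³x/(r₁³r₂³(r₁+r₂)) = (4π/r₁₂⁴)[ln(r₁₂/s₁) + ln(r₁₂/s₂) − (8/3)ln2 + 2/3]`. -/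
theorem pf_integral_inv_r13_r23_r1_plus_r2
    (y₁ y₂ : E3) (hy : y₁ ≠ y₂) (s₁ s₂ : ℝ) (hs₁ : 0 < s₁) (hs₂ : 0 < s₂) :
    Tendsto
      (fun s : ℝ =>
        (∫ x in (Metric.closedBall y₁ s ∪ Metric.closedBall y₂ s)ᶜ,
            1 / (‖x - y₁‖ ^ 3 * ‖x - y₂‖ ^ 3 * (‖x - y₁‖ + ‖x - y₂‖)))
          + 4 * π / ‖y₁ - y₂‖ ^ 4 * Real.log (s / s₁)
          + 4 * π / ‖y₁ - y₂‖ ^ 4 * Real.log (s / s₂))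
      (𝓝[>] (0 : ℝ))
      (𝓝 (4 * π / ‖y₁ - y₂‖ ^ 4 *
        (Real.log (‖y₁ - y₂‖ / s₁) + Real.log (‖y₁ - y₂‖ / s₂)
          - 8 / 3 * Real.log 2 + 2 / 3))) := by
  set c := ‖y₁ - y₂‖ / 2 with hcd
  have hd0 : 0 < ‖y₁ - y₂‖ := norm_pos_iff.2 (sub_ne_zero.2 hy)
  have hc : 0 < c := half_pos hd0
  have hd : ‖y₁ - y₂‖ = 2 * c := by rw [hcd]; ring
  have hlim := ((BB_tendsto hc).sub (GG_lim hc)).const_mul (2 * π) |>.sub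
    (tendsto_const_nhds (x := π / (4 * c ^ 4) * (Real.log s₁ + Real.log s₂)))
  have hval : ∀ᶠ s : ℝ in 𝓝[>] 0,
      ∫ x in (Metric.closedBall y₁ s ∪ Metric.closedBall y₂ s)ᶜ,
        1 / (‖x - y₁‖ ^ 3 * ‖x - y₂‖ ^ 3 * (‖x - y₁‖ + ‖x - y₂‖)) =
      2 * π * (BB c s - GG c (c + s)) := by
    filter_upwards [Ioo_mem_nhdsGT hc] with s hs
    exact integral_value y₁ y₂ hy c s hcd hs.1 hs.2
  rw [hd]
  have hL : 2 * π * (1 / (4 * c ^ 4) - (-(Real.log (2 * c)) / (12 * c ^ 4) + (1 / (2 * c ^ 4) +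
        (Real.log (2 * c) - 2 * Real.log c) / (2 * c ^ 4)) / 3)) -
        π / (4 * c ^ 4) * (Real.log s₁ + Real.log s₂) =
      4 * π / (2 * c) ^ 4 * (Real.log (2 * c / s₁) + Real.log (2 * c / s₂)
          - 8 / 3 * Real.log 2 + 2 / 3) := by
    rw [Real.log_div (by positivity) hs₁.ne', Real.log_div (by positivity) hs₂.ne',
      Real.log_mul (by norm_num) hc.ne']
    field_simp
    ring
  rw [← hL]
  refine hlim.congr' ?_
  filter_upwards [hval, self_mem_nhdsWithin] with s hs hs0
  have hs0' : 0 < s := hs0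
  rw [hs, Real.log_div hs0'.ne' hs₁.ne', Real.log_div hs0'.ne' hs₂.ne']
  field_simp
  ring

end
end

section
/- (Partie finie of a Poisson integral at a singular point.) Let F ∈ 𝓕 with integer exponents and F = O(|x|^{−3−η}) at infinity for some η > 0. For x' ∉ {y₁, y₂} set P(x') := −(1/4π) Pf_{s₁,s₂} ∫ F(x)/|x − x'| d³x, and set P(y₁) := −(1/4π) Pf_{s₁,s₂} ∫ F(x)/r₁ d³x, assuming these partie-finie integrals exist. Then there exist finitely many real numbers c_a, d_a, indexed by negative integers a, such that as r' → 0⁺: (1/4π) ∫_{S²} P(y₁ + r' n') dΩ(n') = Σ_{a<0} (c_a + d_a ln r') r'^a + (r₁²F)₁ ln(r'/s₁) + [ P(y₁) − (r₁²F)₁ ] + o(1), where (r₁²F)₁ = (1/4π) ∫_{S²} f_{−2} dΩ. In particular the Hadamard partie finie of P at y₁ (the r'⁰-part of this expansion, including its ln r' term) equals P(y₁) + [ln(r'/s₁) − 1] (r₁²F)₁, and the dependence on s₁ cancels between the two terms. -/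
open MeasureTheory Filter Topology Real Asymptotics

noncomputable section

instance dOmega_finite : IsFiniteMeasure dOmega := by unfold dOmega; infer_instance

lemma s2_norm (n : S2) : ‖(n : E3)‖ = 1 := by simp

/-- a base point on the sphere -/
def baseS2 : S2 := ⟨EuclideanSpace.single 0 1, by simp⟩

/-- direction of a vector -/
def unitv (x : E3) : S2 :=
  if hx : x = 0 then baseS2 else ⟨‖x‖⁻¹ • x, by simp [norm_smul, hx]⟩

lemma unitv_smul (n : S2) {r : ℝ} (hr : 0 < r) : unitv (r • (n : E3)) = n := by
  have hn := s2_norm n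
  have h0 : (n : E3) ≠ 0 := by intro h; rw [h] at hn; simp at hn
  unfold unitv
  rw [dif_neg (by simp [hr.ne', h0])]
  ext1
  simp [norm_smul, hn, abs_of_pos hr, smul_smul, hr.ne']

lemma norm_smul_unitv (x : E3) (hx : x ≠ 0) : ‖x‖ • (unitv x : E3) = x := by
  unfold unitv
  rw [dif_neg hx]
  simp [smul_smul, hx]

lemma unitv_continuousOn : ContinuousOn unitv {0}ᶜ := by
  rw [continuousOn_iff_continuous_domRestrict]
  refine Continuous.subtype_mk (f := fun x : ({0}ᶜ : Set E3) => ‖(x:E3)‖⁻¹ • (x : E3)) ?_ ?_ |>.congr ?_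
  · exact (continuous_subtype_val.norm.inv₀ (fun x => norm_ne_zero_iff.2 (by exact x.2))).smul continuous_subtype_val
  · intro x
    have : (x : E3) ≠ 0 := x.2
    simp [norm_smul, this]
  · intro x
    have : (x : E3) ≠ 0 := x.2
    simp [unitv, this]

lemma unitv_measurable : Measurable unitv := by
  refine measurable_of_continuousOn_compl_singleton 0 unitv_continuousOn

lemma polar_mul (φ : ℝ → ℝ) (h : S2 → ℝ) :
    ∫ x : E3, φ ‖x‖ * h (unitv x) = (∫ r in Set.Ioi (0:ℝ), r ^ 2 * φ r) * ∫ n, h n ∂dOmega := by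
  have hdim : Module.finrank ℝ E3 = 3 := by simp
  calc
    ∫ x : E3, φ ‖x‖ * h (unitv x)
      = ∫ x : ({(0)}ᶜ : Set E3), φ ‖x.1‖ * h (unitv x.1) ∂((volume : Measure E3).comap (↑)) := by
      rw [integral_subtype_comap (measurableSet_singleton _).compl fun x : E3 ↦ φ ‖x‖ * h (unitv x),
        restrict_compl_singleton]
    _ = ∫ x, h x.1 * φ x.2 ∂(volume : Measure E3).toSphere.prod (.volumeIoiPow (Module.finrank ℝ E3 - 1)) := by
      rw [← (volume : Measure E3).measurePreserving_homeomorphUnitSphereProd.integral_comp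
        (Homeomorph.measurableEmbedding _)]
      congr 1
      ext x
      have hx : (x : E3) ≠ 0 := x.2
      have : unitv (x : E3) = (homeomorphUnitSphereProd E3 x).1 := by
        ext1
        simp [unitv, hx]
      rw [this]
      simp [mul_comm]
    _ = (∫ n, h n ∂dOmega) * ∫ x : Set.Ioi (0 : ℝ), φ x ∂.volumeIoiPow (Module.finrank ℝ E3 - 1) :=
      integral_prod_mul (μ := (volume : Measure E3).toSphere) (ν := .volumeIoiPow (Module.finrank ℝ E3 - 1)) h (fun r : Set.Ioi (0:ℝ) => φ r)
    _ = _ := by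
      rw [hdim, mul_comm]
      congr 1
      simp only [Measure.volumeIoiPow, ENNReal.ofReal]
      rw [integral_withDensity_eq_integral_smul,
        integral_subtype_comap measurableSet_Ioi fun a ↦ Real.toNNReal (a ^ (3-1)) • φ a,
        setIntegral_congr_fun measurableSet_Ioi fun x hx ↦ ?_]
      · rw [NNReal.smul_def, Real.coe_toNNReal _ (pow_nonneg hx.out.le _)]
        simp
      · exact (measurable_subtype_coe.pow_const _).real_toNNReal

lemma gauss_moment (k : ℕ) (e : E3) (he : ‖e‖ = 1) :
    ∫ x : E3, (inner ℝ x e) ^ k * Real.exp (-‖x‖^2) =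
      (∫ t : ℝ, t ^ k * Real.exp (-t^2)) * π := by
  obtain ⟨b, hb⟩ : ∃ b : OrthonormalBasis (Fin 3) ℝ E3, b 0 = e := by
    have ho : Orthonormal ℝ (({0} : Set (Fin 3)).domRestrict (fun _ : Fin 3 => e)) := by
      constructor
      · intro i; exact he
      · intro i j hij
        exact absurd (Subsingleton.elim i j) hij
    obtain ⟨b, hb⟩ := ho.exists_orthonormalBasis_extension_of_card_eq (by simp)
    exact ⟨b, hb 0 (by simp)⟩
  have h1 : ∫ x : E3, (inner ℝ x e) ^ k * Real.exp (-‖x‖^2)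
      = ∫ x : E3, (x 0) ^ k * Real.exp (-‖x‖^2) := by
    rw [← b.measurePreserving_repr.integral_comp (b.repr.toHomeomorph.measurableEmbedding)
      (fun x : E3 => (x 0) ^ k * Real.exp (-‖x‖^2))]
    congr 1
    ext x
    rw [b.repr_apply_apply, hb, real_inner_comm, LinearIsometryEquiv.norm_map]
  rw [h1, ← (PiLp.volume_preserving_toLp (Fin 3)).integral_comp (MeasurableEquiv.toLp 2 _).measurableEmbedding]
  have h2 : ∀ x : Fin 3 → ℝ, ((WithLp.toLp 2 x : E3) 0) ^ k * Real.exp (-‖(WithLp.toLp 2 x : E3)‖^2)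
     = ∏ i, (![fun t : ℝ => t ^ k * Real.exp (-t^2), fun t => Real.exp (-t^2), fun t => Real.exp (-t^2)] i) (x i) := by
    intro x
    rw [EuclideanSpace.norm_sq_eq]
    simp [Fin.prod_univ_three, Fin.sum_univ_three]
    rw [mul_assoc, mul_assoc, ← Real.exp_add, ← Real.exp_add]
    congr 2; ring
  simp_rw [h2]
  rw [integral_fintype_prod_volume_eq_prod]
  have h3 := integral_gaussian 1
  simp at h3
  simp [Fin.prod_univ_three, h3, mul_assoc, Real.mul_self_sqrt Real.pi_pos.le]

lemma sphere_moment (k : ℕ) (e : E3) (he : ‖e‖ = 1) :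
    ∫ n : S2, (inner ℝ (n : E3) e) ^ k ∂dOmega = 2 * π * ∫ t in (-1:ℝ)..1, t ^ k := by
  have hg := gauss_moment k e he
  have hp := polar_mul (fun r => r ^ k * Real.exp (-r^2)) (fun n => (inner ℝ (n : E3) e) ^ k)
  have hEq : ∫ x : E3, (inner ℝ x e) ^ k * Real.exp (-‖x‖^2)
      = ∫ x : E3, ‖x‖ ^ k * Real.exp (-‖x‖^2) * (inner ℝ (unitv x : E3) e) ^ k := by
    apply integral_congr_ae
    have : ∀ᵐ x : E3, x ≠ 0 := by
      rw [ae_iff]; simp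
    filter_upwards [this] with x hx
    nth_rw 1 [← norm_smul_unitv x hx]
    rw [inner_smul_left, mul_pow]
    simp; ring
  rw [← hEq, hg] at hp
  have hR : ∫ r in Set.Ioi (0:ℝ), r ^ 2 * (r ^ k * Real.exp (-r^2))
      = (1/2) * Real.Gamma ((k+3)/2) := by
    have := integral_rpow_mul_exp_neg_rpow (p := 2) (q := k + 2) (by norm_num) (by linarith [(Nat.cast_nonneg k : (0:ℝ) ≤ k)])
    rw [show ((k:ℝ)+3)/2 = (k + 2 + 1)/2 by ring, ← this]
    apply setIntegral_congr_fun measurableSet_Ioi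
    intro x hx
    have hx : 0 < x := hx
    simp only
    rw [show ((k:ℝ)+2) = ((k+2 : ℕ) : ℝ) by push_cast; ring, Real.rpow_natCast, Real.rpow_two]
    ring
  have hGpos : 0 < Real.Gamma (((k:ℝ)+1)/2) := Real.Gamma_pos_of_pos (by positivity)
  have hG : Real.Gamma (((k:ℝ)+3)/2) = ((k:ℝ)+1)/2 * Real.Gamma (((k:ℝ)+1)/2) := by
    rw [← Real.Gamma_add_one (by positivity)]; congr 1; ring
  rw [hR, hG] at hp
  rw [integral_pow]
  have hk1 : (0:ℝ) < k + 1 := by positivity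
  rcases Nat.even_or_odd k with hk | hk
  · have h1 : ∫ t : ℝ, t ^ k * Real.exp (-t^2) = Real.Gamma (((k:ℝ)+1)/2) := by
      have := integral_comp_abs (f := fun t : ℝ => t ^ k * Real.exp (-t^2))
      simp only [hk.pow_abs, sq_abs] at this
      rw [this]
      have h2 := integral_rpow_mul_exp_neg_rpow (p := 2) (q := k) (by norm_num) (by linarith [(Nat.cast_nonneg k : (0:ℝ) ≤ k)])
      simp only [Real.rpow_natCast, Real.rpow_two] at h2
      rw [h2]; ring
    rw [h1] at hp
    rw [(hk.add_one).neg_one_pow]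
    simp
    field_simp at hp ⊢
    linarith
  · have h1 : ∫ t : ℝ, t ^ k * Real.exp (-t^2) = 0 := by
      have := integral_neg_eq_self (fun t : ℝ => t ^ k * Real.exp (-t^2)) volume
      simp only [hk.neg_pow, neg_sq, neg_mul, integral_neg] at this
      linarith
    rw [h1] at hp
    rw [(hk.add_one).neg_one_pow]
    simp
    simpa [hk1.ne', hGpos.ne'] using hp

lemma archimedes (f : ℝ → ℝ) (hf : ContinuousOn f (Set.Icc (-1) 1)) (e : E3) (he : ‖e‖ = 1) :
    ∫ n : S2, f (inner ℝ (n : E3) e) ∂dOmega = 2 * π * ∫ t in (-1:ℝ)..1, f t := by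
  have hmem : ∀ n : S2, (inner ℝ (n : E3) e : ℝ) ∈ Set.Icc (-1:ℝ) 1 := by
    intro n
    have := abs_real_inner_le_norm (n : E3) e
    rw [s2_norm, he, one_mul] at this
    exact abs_le.1 this
  have hci : Continuous fun n : S2 => (inner ℝ (n : E3) e : ℝ) := by fun_prop
  have hcf : Continuous fun n : S2 => f (inner ℝ (n : E3) e) := hf.comp_continuous hci hmem
  have hIntg : ∀ g : S2 → ℝ, Continuous g → Integrable g dOmega := fun g hg =>
    hg.integrable_of_hasCompactSupport (HasCompactSupport.of_compactSpace g)
  have hpoly : ∀ p : Polynomial ℝ, ∫ n : S2, p.eval (inner ℝ (n : E3) e) ∂dOmega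
      = 2 * π * ∫ t in (-1:ℝ)..1, p.eval t := by
    intro p
    simp only [Polynomial.eval_eq_sum_range]
    rw [integral_finsetSum _ (fun i _ => hIntg _ (by fun_prop)), intervalIntegral.integral_finsetSum
      (fun i _ => Continuous.intervalIntegrable (by fun_prop) _ _), Finset.mul_sum]
    refine Finset.sum_congr rfl fun i _ => ?_
    rw [integral_const_mul, intervalIntegral.integral_const_mul, sphere_moment i e he]
    ring
  have hmass : dOmega.real Set.univ = 4 * π := by
    have := hpoly 1
    simp at this
    rw [this]; ring
  have hfi : IntervalIntegrable f volume (-1) 1 := by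
    apply ContinuousOn.intervalIntegrable
    rwa [Set.uIcc_of_le (by norm_num)]
  have key : ∀ ε > 0, |∫ n : S2, f (inner ℝ (n : E3) e) ∂dOmega - 2 * π * ∫ t in (-1:ℝ)..1, f t| ≤ 8 * π * ε := by
    intro ε hε
    obtain ⟨p, hp⟩ := exists_polynomial_near_of_continuousOn (-1) 1 f hf ε hε
    have h1 : |∫ n : S2, p.eval (inner ℝ (n : E3) e) - f (inner ℝ (n : E3) e) ∂dOmega| ≤ ε * (4 * π) := by
      rw [← hmass, ← Real.norm_eq_abs]
      exact norm_integral_le_of_norm_le_const (Eventually.of_forall fun n => (hp _ (hmem n)).le)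
    have h2 : |∫ t in (-1:ℝ)..1, (p.eval t - f t)| ≤ ε * |1 - (-1)| := by
      rw [← Real.norm_eq_abs (∫ t in (-1:ℝ)..1, (p.eval t - f t))]
      apply intervalIntegral.norm_integral_le_of_norm_le_const
      intro t ht
      rw [Set.uIoc_of_le (by norm_num)] at ht
      exact (hp t ⟨ht.1.le, ht.2⟩).le
    rw [integral_sub (hIntg _ (by fun_prop)) (hIntg _ hcf), hpoly] at h1
    rw [intervalIntegral.integral_sub (Continuous.intervalIntegrable (by fun_prop) _ _) hfi] at h2
    have hpi := Real.pi_pos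
    rw [show |(1:ℝ) - (-1)| = 2 by norm_num, abs_le] at h2
    rw [abs_le] at h1 ⊢
    constructor <;> nlinarith [h1.1, h1.2, mul_le_mul_of_nonneg_left h2.1 hpi.le, mul_le_mul_of_nonneg_left h2.2 hpi.le]
  by_contra hne
  have hpos : 0 < |∫ n : S2, f (inner ℝ (n : E3) e) ∂dOmega - 2 * π * ∫ t in (-1:ℝ)..1, f t| :=
    abs_pos.2 (sub_ne_zero.2 hne)
  have hpi := Real.pi_pos
  have := key (|∫ n : S2, f (inner ℝ (n : E3) e) ∂dOmega - 2 * π * ∫ t in (-1:ℝ)..1, f t| / (16 * π)) (by positivity)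
  rw [show 8 * π * (|∫ n : S2, f (inner ℝ (n : E3) e) ∂dOmega - 2 * π * ∫ t in (-1:ℝ)..1, f t| / (16 * π)) = |∫ n : S2, f (inner ℝ (n : E3) e) ∂dOmega - 2 * π * ∫ t in (-1:ℝ)..1, f t| / 2 by field_simp; ring] at this
  linarith

lemma dOmega_mass : dOmega.real Set.univ = 4 * π := by
  have := sphere_moment 0 (EuclideanSpace.single 0 1) (by simp)
  simp at this
  rw [this]; ring


lemma newton (x : E3) (ρ : ℝ) (hρ : 0 < ρ) (hne : ‖x‖ ≠ ρ) :
    ∫ n : S2, ‖x - ρ • (n : E3)‖⁻¹ ∂dOmega = 4 * π * (max ‖x‖ ρ)⁻¹ := by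
  by_cases hx : x = 0
  · subst hx
    simp only [zero_sub, norm_neg, norm_smul, s2_norm, norm_zero, max_eq_right hρ.le]
    simp [dOmega_mass, abs_of_pos hρ]
  have hR : 0 < ‖x‖ := norm_pos_iff.2 hx
  set R := ‖x‖ with hRdef
  have hpos : ∀ t ∈ Set.Icc (-1:ℝ) 1, 0 < R^2 + ρ^2 - 2*R*ρ*t := by
    intro t ht
    have h1 : 0 < (R - ρ)^2 := by have := sub_ne_zero.2 hne; positivity
    have h2 : R * ρ * t ≤ R * ρ * 1 := mul_le_mul_of_nonneg_left ht.2 (by positivity)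
    nlinarith
  have hA := archimedes (fun t => (Real.sqrt (R^2 + ρ^2 - 2*R*ρ*t))⁻¹)
    (by
      apply ContinuousOn.inv₀ (by fun_prop)
      intro t ht
      exact (Real.sqrt_pos.2 (hpos t ht)).ne') (R⁻¹ • x) (by simp [norm_smul, ← hRdef, hR.ne', abs_of_pos hR])
  have hI : ∫ t in (-1:ℝ)..1, (Real.sqrt (R^2 + ρ^2 - 2*R*ρ*t))⁻¹ = 2 * (max R ρ)⁻¹ := by
    rw [intervalIntegral.integral_eq_sub_of_hasDerivAt (f := fun t => - Real.sqrt (R^2 + ρ^2 - 2*R*ρ*t) / (R*ρ))]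
    · have e1 : R^2 + ρ^2 - 2*R*ρ*1 = (R-ρ)^2 := by ring
      have e2 : R^2 + ρ^2 - 2*R*ρ*(-1) = (R+ρ)^2 := by ring
      rw [e1, e2, Real.sqrt_sq_eq_abs, Real.sqrt_sq (by positivity)]
      rcases le_total R ρ with h | h
      · rw [max_eq_right h, abs_of_nonpos (by linarith)]
        field_simp; ring
      · rw [max_eq_left h, abs_of_nonneg (by linarith)]
        field_simp; ring
    · intro t ht
      rw [Set.uIcc_of_le (by norm_num)] at ht
      have hp := hpos t ht
      have hd : HasDerivAt (fun t : ℝ => R^2 + ρ^2 - 2*R*ρ*t) (-(2*R*ρ)) t := by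
        simpa using ((hasDerivAt_id t).const_mul (2*R*ρ)).const_sub (R^2+ρ^2)
      have := ((hd.sqrt hp.ne').neg).div_const (R*ρ)
      refine HasDerivAt.congr_deriv this ?_
      have h5 := (Real.sqrt_pos.2 hp).ne'
      generalize Real.sqrt (R^2 + ρ^2 - 2*R*ρ*t) = q at h5 ⊢
      field_simp
    · apply ContinuousOn.intervalIntegrable
      rw [Set.uIcc_of_le (by norm_num)]
      apply ContinuousOn.inv₀ (by fun_prop)
      intro t ht
      exact (Real.sqrt_pos.2 (hpos t ht)).ne'
  rw [hI] at hA
  rw [show 4 * π * (max R ρ)⁻¹ = 2 * π * (2 * (max R ρ)⁻¹) by ring, ← hA]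
  congr 1
  ext n
  congr 1
  rw [eq_comm, Real.sqrt_eq_iff_mul_self_eq_of_pos]
  · rw [← sq, norm_sub_sq_real, norm_smul, s2_norm, inner_smul_right, inner_smul_right, Real.norm_eq_abs, mul_one, sq_abs,
      real_inner_comm, ← hRdef]
    field_simp
    ring
  · rw [norm_pos_iff, sub_ne_zero]
    intro h
    apply hne
    rw [hRdef, h, norm_smul, s2_norm, Real.norm_eq_abs, abs_of_pos hρ, mul_one]

lemma s2_integrable {g : S2 → ℝ} (hg : Continuous g) : Integrable g dOmega :=
  hg.integrable_of_hasCompactSupport (HasCompactSupport.of_compactSpace g)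



lemma rpow_tendsto_zero {a : ℝ} (ha : 0 < a) : Tendsto (fun r : ℝ => r ^ a) (𝓝[>] 0) (𝓝 0) := by
  have := (Real.continuousAt_rpow_const 0 a (Or.inr ha.le)).tendsto
  rw [Real.zero_rpow ha.ne'] at this
  exact this.mono_left nhdsWithin_le_nhds

lemma vanish {ι : Type*} (I : Finset ι) (e h : ι → ℝ)
    (H : Tendsto (fun r : ℝ => ∑ i ∈ I, r ^ (e i) * h i) (𝓝[>] 0) (𝓝 0)) (a : ℝ) (ha : a ≤ 0) :
    ∑ i ∈ I with e i = a, h i = 0 := by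
  classical
  set Hs : ℝ → ℝ := fun b => ∑ i ∈ I with e i = b, h i with hHs
  by_contra hne
  set S := (I.image e).filter (fun b => b ≤ 0 ∧ Hs b ≠ 0) with hS
  have haS : a ∈ S := by
    rw [hS, Finset.mem_filter]
    refine ⟨?_, ha, hne⟩
    obtain ⟨i, hi, -⟩ := Finset.exists_ne_zero_of_sum_ne_zero hne
    rw [Finset.mem_filter] at hi
    exact Finset.mem_image.2 ⟨i, hi.1, hi.2⟩
  obtain ⟨b0, hb0, hmin⟩ := Finset.exists_min_image S id ⟨a, haS⟩
  simp only [id] at hmin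
  rw [hS, Finset.mem_filter] at hb0
  have hgroup : ∀ r : ℝ, ∑ i ∈ I, r ^ (e i) * h i = ∑ b ∈ I.image e, r ^ b * Hs b := by
    intro r
    rw [← Finset.sum_fiberwise_of_maps_to (g := e) (t := I.image e) (fun i hi => Finset.mem_image_of_mem e hi)]
    refine Finset.sum_congr rfl fun b _ => ?_
    rw [hHs, Finset.mul_sum]
    refine Finset.sum_congr rfl fun i hi => ?_
    rw [(Finset.mem_filter.1 hi).2]
  have h1 : Tendsto (fun r : ℝ => r ^ (-b0) * ∑ i ∈ I, r ^ (e i) * h i) (𝓝[>] 0) (𝓝 0) := by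
    rcases hb0.2.1.lt_or_eq with hlt | heq
    · simpa using (rpow_tendsto_zero (neg_pos.2 hlt)).mul H
    · simpa [heq] using H
  have h2 : Tendsto (fun r : ℝ => ∑ b ∈ I.image e, r ^ (b - b0) * Hs b) (𝓝[>] 0)
      (𝓝 (∑ b ∈ I.image e, if b = b0 then Hs b0 else 0)) := by
    refine tendsto_finsetSum _ fun b hb => ?_
    split_ifs with hbb
    · subst hbb; simp
    · rcases lt_or_gt_of_ne hbb with hlt | hgt
      · have : Hs b = 0 := by
          by_contra h0
          exact absurd (hmin b (by rw [hS, Finset.mem_filter]; exact ⟨hb, by linarith [hb0.2.1], h0⟩)) (not_le.2 hlt)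
        simp [this]
      · simpa using (rpow_tendsto_zero (sub_pos.2 hgt)).mul_const (Hs b)
  rw [Finset.sum_ite_eq' , if_pos hb0.1] at h2
  have h3 : (fun r : ℝ => r ^ (-b0) * ∑ i ∈ I, r ^ (e i) * h i) =ᶠ[𝓝[>] 0]
      fun r : ℝ => ∑ b ∈ I.image e, r ^ (b - b0) * Hs b := by
    filter_upwards [self_mem_nhdsWithin] with r hr
    rw [hgroup, Finset.mul_sum]
    refine Finset.sum_congr rfl fun b _ => ?_
    rw [← mul_assoc, ← Real.rpow_add hr]; congr 2; ring
  exact hb0.2.2 (tendsto_nhds_unique h2 (h1.congr' h3))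

lemma uniq {ι κ : Type*} (g : ℝ → ℝ) (I : Finset ι) (e h : ι → ℝ) (J : Finset κ) (e' h' : κ → ℝ)
    (H1 : Tendsto (fun r : ℝ => r * (g r - ∑ i ∈ I, r ^ (e i) * h i)) (𝓝[>] 0) (𝓝 0))
    (H2 : Tendsto (fun r : ℝ => r * (g r - ∑ i ∈ J, r ^ (e' i) * h' i)) (𝓝[>] 0) (𝓝 0))
    (a : ℝ) (ha : a ≤ -1) :
    ∑ i ∈ I with e i = a, h i = ∑ i ∈ J with e' i = a, h' i := by
  classical
  have := vanish (I.disjSum J) (Sum.elim (fun i => e i + 1) (fun i => e' i + 1)) (Sum.elim h (fun i => - h' i)) (by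
    have := H2.sub H1
    rw [sub_zero] at this
    refine this.congr' ?_
    filter_upwards [self_mem_nhdsWithin] with r hr
    have hr : 0 < r := hr
    rw [Finset.sum_disjSum, ← mul_sub, sub_sub_sub_cancel_left, mul_sub, Finset.mul_sum, Finset.mul_sum, sub_eq_add_neg,
      ← Finset.sum_neg_distrib]
    congr 1
    · refine Finset.sum_congr rfl fun i _ => ?_
      simp [Real.rpow_add hr]; ring
    · refine Finset.sum_congr rfl fun i _ => ?_
      simp [Real.rpow_add hr]; ring) (a+1) (by linarith)
  rw [Finset.sum_filter, Finset.sum_disjSum] at this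
  simp only [Sum.elim_inl, Sum.elim_inr, add_left_inj] at this
  have h3 : (∑ x ∈ J, if e' x = a then -h' x else 0) = - ∑ x ∈ J, if e' x = a then h' x else 0 := by
    rw [← Finset.sum_neg_distrib]
    refine Finset.sum_congr rfl fun i _ => ?_
    split_ifs <;> simp
  rw [h3] at this
  rw [Finset.sum_filter, Finset.sum_filter]
  linarith

lemma sing_finset {y : E3} {G : E3 → ℝ} {p : ℝ → S2 → ℝ} (h : HasSingExpansion y G p) (r : ℝ) (n : S2) :
    ∑ᶠ (a : ℝ) (_ : a ≤ ((0:ℕ) : ℝ)), r ^ a * p a n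
      = ∑ a ∈ (h.finite_exponents 0).toFinset, r ^ a * p a n := by
  simp only [Nat.cast_zero]
  simp only [finsum_eq_if]
  rw [finsum_eq_sum_of_support_subset (s := (h.finite_exponents 0).toFinset)]
  · refine Finset.sum_congr rfl fun a ha => ?_
    simp at ha
    rw [if_pos ha.1]
  · intro a ha
    rw [Function.mem_support] at ha
    simp
    split_ifs at ha with h0
    · refine ⟨h0, fun hp => ?_⟩
      simp [hp] at ha
    · simp at ha

lemma sing_tendsto {y : E3} {G : E3 → ℝ} {p : ℝ → S2 → ℝ} (h : HasSingExpansion y G p) (n : S2) :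
    Tendsto (fun r : ℝ => G (y + r • (n : E3)) - ∑ a ∈ (h.finite_exponents 0).toFinset, r ^ a * p a n)
      (𝓝[>] 0) (𝓝 0) := by
  rw [Metric.tendsto_nhds]
  intro ε hε
  obtain ⟨δ, hδ, H⟩ := h.expansion 0 (ε/2) (by positivity)
  filter_upwards [Ioo_mem_nhdsGT hδ] with r hr
  have := H r hr.1 hr.2 n
  rw [sing_finset h] at this
  rw [dist_zero_right, Real.norm_eq_abs]
  simp at this
  linarith

lemma id_tendsto : Tendsto (fun r : ℝ => r) (𝓝[>] 0) (𝓝 0) := tendsto_id.mono_left nhdsWithin_le_nhds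

lemma coeff_eq {ι : Type*} {y : E3} {G : E3 → ℝ} {p : ℝ → S2 → ℝ} (hG : HasSingExpansion y G p)
    (I : Finset ι) (e : ι → ℝ) (h : ι → S2 → ℝ)
    (H : ∀ n : S2, Tendsto (fun r : ℝ => r * (G (y + r • (n : E3)) - ∑ i ∈ I, r ^ (e i) * h i n)) (𝓝[>] 0) (𝓝 0))
    (a : ℝ) (ha : a ≤ -1) (n : S2) : p a n = ∑ i ∈ I with e i = a, h i n := by
  rw [← uniq (fun r => G (y + r • (n : E3))) (hG.finite_exponents 0).toFinset id (fun a => p a n) I e (fun i => h i n)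
    (by simpa using id_tendsto.mul (sing_tendsto hG n)) (H n) a ha]
  simp only [id]
  rw [Finset.sum_filter, Finset.sum_ite_eq']
  split_ifs with hm
  · rfl
  · simp at hm
    rw [hm (by linarith)]; rfl

/-- the divergent subtraction terms -/
def Dv (p : ℝ → S2 → ℝ) (s₁ s : ℝ) : ℝ :=
  (∑ᶠ (a : ℝ) (_ : a < -3), s ^ (a + 3) / (a + 3) * ∫ n : S2, p a n ∂dOmega)
    + Real.log (s / s₁) * (∫ n : S2, p (-3) n ∂dOmega)

def tauD (s₁ s a : ℝ) : ℝ :=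
  if a < -3 then s ^ (a + 3) / (a + 3) else if a = -3 then Real.log (s / s₁) else 0

lemma pfApprox_eq (y₁ y₂ : E3) (s₁ s₂ : ℝ) (F : E3 → ℝ) (c d : ℝ → S2 → ℝ) (s : ℝ) :
    pfApprox y₁ y₂ s₁ s₂ F c d s =
    (∫ x in (Metric.closedBall y₁ s ∪ Metric.closedBall y₂ s)ᶜ, F x) + Dv c s₁ s + Dv d s₂ s := by
  unfold pfApprox Dv; ring

lemma Dv_eq {ι : Type*} {y : E3} {G : E3 → ℝ} {p : ℝ → S2 → ℝ} (hG : HasSingExpansion y G p)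
    (I : Finset ι) (e : ι → ℝ) (h : ι → S2 → ℝ) (hc : ∀ i ∈ I, Continuous (h i))
    (H : ∀ n : S2, Tendsto (fun r : ℝ => r * (G (y + r • (n : E3)) - ∑ i ∈ I, r ^ (e i) * h i n)) (𝓝[>] 0) (𝓝 0))
    (s₁ s : ℝ) : Dv p s₁ s = ∑ i ∈ I, tauD s₁ s (e i) * ∫ n, h i n ∂dOmega := by
  classical
  have hp : ∀ a ≤ (-1:ℝ), ∫ n, p a n ∂dOmega = ∑ i ∈ I with e i = a, ∫ n, h i n ∂dOmega := by
    intro a ha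
    simp_rw [coeff_eq hG I e h H a ha]
    rw [integral_finsetSum]
    intro i hi
    exact s2_integrable (hc i (Finset.mem_filter.1 hi).1)
  have hfs : (∑ᶠ (a : ℝ) (_ : a < -3), s ^ (a + 3) / (a + 3) * ∫ n : S2, p a n ∂dOmega)
      = ∑ a ∈ I.image e, if a < -3 then s ^ (a + 3) / (a + 3) * ∑ i ∈ I with e i = a, ∫ n, h i n ∂dOmega else 0 := by
    simp only [finsum_eq_if]
    rw [finsum_eq_sum_of_support_subset (s := I.image e)]
    · refine Finset.sum_congr rfl fun a ha => ?_
      split_ifs with h3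
      · rw [hp a (by linarith)]
      · rfl
    · intro a ha
      rw [Function.mem_support] at ha
      split_ifs at ha with h0
      · rw [hp a (by linarith)] at ha
        obtain ⟨i, hi, -⟩ := Finset.exists_ne_zero_of_sum_ne_zero (right_ne_zero_of_mul ha)
        rw [Finset.mem_filter] at hi
        exact Finset.mem_coe.2 (Finset.mem_image.2 ⟨i, hi.1, hi.2⟩)
      · simp at ha
  have hlog : Real.log (s / s₁) * (∫ n : S2, p (-3) n ∂dOmega) =
     ∑ i ∈ I, (if e i = -3 then Real.log (s/s₁) * ∫ n, h i n ∂dOmega else 0) := by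
    rw [hp _ (by norm_num), Finset.mul_sum, Finset.sum_filter]
  rw [Dv, hfs, hlog]
  rw [← Finset.sum_fiberwise_of_maps_to (g := e) (t := I.image e) (fun i hi => Finset.mem_image_of_mem e hi)
    (fun i => tauD s₁ s (e i) * ∫ n, h i n ∂dOmega)]
  rw [← Finset.sum_fiberwise_of_maps_to (g := e) (t := I.image e) (fun i hi => Finset.mem_image_of_mem e hi)
    (fun i => (if e i = -3 then Real.log (s/s₁) * ∫ n, h i n ∂dOmega else 0)), ← Finset.sum_add_distrib]
  refine Finset.sum_congr rfl fun a _ => ?_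
  have e1 : ∑ i ∈ I with e i = a, tauD s₁ s (e i) * ∫ n, h i n ∂dOmega
      = tauD s₁ s a * ∑ i ∈ I with e i = a, ∫ n, h i n ∂dOmega := by
    rw [Finset.mul_sum]
    refine Finset.sum_congr rfl fun i hi => ?_
    rw [(Finset.mem_filter.1 hi).2]
  have e2 : ∑ i ∈ I with e i = a, (if e i = -3 then Real.log (s/s₁) * ∫ n, h i n ∂dOmega else 0)
      = (if a = -3 then Real.log (s/s₁) else 0) * ∑ i ∈ I with e i = a, ∫ n, h i n ∂dOmega := by
    rw [Finset.mul_sum]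
    refine Finset.sum_congr rfl fun i hi => ?_
    rw [(Finset.mem_filter.1 hi).2]
    split_ifs <;> simp
  rw [e1, e2, tauD]
  split_ifs with h1 h2 h2
  · linarith
  · ring
  · ring
  · ring



/-- annulus -/
def ann (y : E3) (s δ : ℝ) : Set E3 := Metric.closedBall y δ \ Metric.closedBall y s

lemma mem_ann {y x : E3} {s δ : ℝ} : x ∈ ann y s δ ↔ s < ‖x - y‖ ∧ ‖x - y‖ ≤ δ := by
  simp [ann, dist_eq_norm, and_comm]

lemma ann_meas (y : E3) (s δ : ℝ) : MeasurableSet (ann y s δ) :=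
  Metric.isClosed_closedBall.measurableSet.diff Metric.isClosed_closedBall.measurableSet

lemma ann_mul (y : E3) {s δ : ℝ} (hs : 0 ≤ s) (hsδ : s ≤ δ) (φ : ℝ → ℝ) (h : S2 → ℝ) :
    ∫ x in ann y s δ, φ ‖x - y‖ * h (unitv (x - y)) = (∫ r in s..δ, r ^ 2 * φ r) * ∫ n, h n ∂dOmega := by
  rw [← integral_indicator (ann_meas y s δ)]
  have h1 : ∀ x : E3, (ann y s δ).indicator (fun x => φ ‖x - y‖ * h (unitv (x - y))) x
      = (fun z : E3 => (Set.Ioc s δ).indicator φ ‖z‖ * h (unitv z)) (x - y) := by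
    intro x
    by_cases hx : x ∈ ann y s δ
    · rw [Set.indicator_of_mem hx]
      simp only
      rw [Set.indicator_of_mem (by exact mem_ann.1 hx)]
    · rw [Set.indicator_of_notMem hx]
      simp only
      rw [Set.indicator_of_notMem (s := Set.Ioc s δ) (fun hh => hx (mem_ann.2 hh)), zero_mul]
  simp_rw [h1]
  rw [integral_sub_right_eq_self (fun z : E3 => (Set.Ioc s δ).indicator φ ‖z‖ * h (unitv z)) y, polar_mul]
  congr 1
  rw [intervalIntegral.integral_of_le hsδ]
  have h2 : ∀ r : ℝ, r ^ 2 * (Set.Ioc s δ).indicator φ r = (Set.Ioc s δ).indicator (fun r => r^2 * φ r) r := by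
    intro r
    by_cases hr : r ∈ Set.Ioc s δ
    · simp [hr]
    · simp [hr]
  simp_rw [h2]
  rw [setIntegral_indicator measurableSet_Ioc]
  congr 2
  ext r; simp; intro h _; linarith

lemma ann_integrable (y : E3) {s δ : ℝ} (hs : 0 < s) (φ : ℝ → ℝ) (hφ : ContinuousOn φ (Set.Ioi 0)) (h : S2 → ℝ)
    (hh : Continuous h) : IntegrableOn (fun x => φ ‖x - y‖ * h (unitv (x - y))) (ann y s δ) := by
  have hsub : ann y s δ ⊆ Metric.closedBall y δ \ Metric.ball y s :=
    Set.sdiff_subset_sdiff_right Metric.ball_subset_closedBall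
  refine IntegrableOn.mono_set ?_ hsub
  have hne : ∀ x ∈ Metric.closedBall y δ \ Metric.ball y s, x - y ≠ 0 := by
    intro x hx h0
    rw [sub_eq_zero] at h0
    subst h0
    exact hx.2 (Metric.mem_ball_self hs)
  apply ContinuousOn.integrableOn_compact
  · exact (isCompact_closedBall y δ).diff Metric.isOpen_ball
  · refine ContinuousOn.mul ?_ ?_
    · exact hφ.comp (by fun_prop) (fun x hx => norm_pos_iff.2 (hne x hx))
    · exact hh.comp_continuousOn (unitv_continuousOn.comp (by fun_prop) (fun x hx => hne x hx))

lemma ann_est {ι : Type*} (y : E3) {s δ : ℝ} (hs : 0 < s) (hsδ : s ≤ δ) (G : E3 → ℝ)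
    (hG : IntegrableOn G (ann y s δ)) (I : Finset ι) (e : ι → ℝ) (h : ι → S2 → ℝ)
    (hc : ∀ i ∈ I, Continuous (h i)) (B : ℝ) (hB : 0 ≤ B)
    (H : ∀ r, s < r → r ≤ δ → ∀ n : S2, |G (y + r • (n : E3)) - ∑ i ∈ I, r ^ (e i) * h i n| ≤ B * r⁻¹) :
    |(∫ x in ann y s δ, G x) - ∑ i ∈ I, (∫ r in s..δ, r ^ (e i + 2)) * ∫ n, h i n ∂dOmega| ≤ B * (2 * π * δ ^ 2) := by
  have hi : ∀ i ∈ I, IntegrableOn (fun x => ‖x - y‖ ^ (e i) * h i (unitv (x - y))) (ann y s δ) := by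
    intro i hi
    refine ann_integrable y hs (fun r => r ^ (e i)) ?_ (h i) (hc i hi)
    intro r hr
    exact (Real.continuousAt_rpow_const r (e i) (Or.inl (ne_of_gt hr))).continuousWithinAt
  have hsum : ∑ i ∈ I, (∫ r in s..δ, r ^ (e i + 2)) * ∫ n, h i n ∂dOmega
      = ∫ x in ann y s δ, ∑ i ∈ I, ‖x - y‖ ^ (e i) * h i (unitv (x - y)) := by
    rw [integral_finsetSum _ hi]
    refine Finset.sum_congr rfl fun i _ => ?_
    rw [ann_mul y hs.le hsδ (fun r => r ^ (e i))]
    congr 1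
    apply intervalIntegral.integral_congr
    intro r hr
    rw [Set.uIcc_of_le hsδ] at hr
    have : 0 < r := lt_of_lt_of_le hs hr.1
    simp only
    rw [Real.rpow_add this, Real.rpow_two, mul_comm]
  rw [hsum, ← integral_sub hG (integrable_finsetSum _ hi)]
  have hbd : IntegrableOn (fun x : E3 => B * ‖x - y‖⁻¹) (ann y s δ) := by
    have := ann_integrable y (δ := δ) hs (fun r => B * r⁻¹) (by
      apply ContinuousOn.mul continuousOn_const
      exact continuousOn_inv₀.mono (fun r hr => ne_of_gt hr)) (fun _ => 1) continuous_const
    simpa using this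
  have hval : ∫ x in ann y s δ, B * ‖x - y‖⁻¹ = B * ((δ^2 - s^2)/2) * (4 * π) := by
    have := ann_mul y hs.le hsδ (fun r => B * r⁻¹) (fun _ => 1)
    simp only [mul_one] at this
    rw [this]
    have h2 : ∫ r in s..δ, r ^ 2 * (B * r⁻¹) = ∫ r in s..δ, B * r := by
      apply intervalIntegral.integral_congr
      intro r hr
      rw [Set.uIcc_of_le hsδ] at hr
      have : 0 < r := lt_of_lt_of_le hs hr.1
      simp only
      field_simp
    rw [h2, intervalIntegral.integral_const_mul, integral_id]
    simp [dOmega_mass]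
  rw [← Real.norm_eq_abs]
  refine (norm_integral_le_of_norm_le hbd ?_).trans ?_
  · filter_upwards [ae_restrict_mem (ann_meas y s δ)] with x hx
    have hx := mem_ann.1 hx
    have := H ‖x - y‖ hx.1 hx.2 (unitv (x - y))
    rw [norm_smul_unitv _ (norm_pos_iff.1 (hs.trans hx.1)), add_sub_cancel] at this
    exact this
  · rw [hval]
    have := Real.pi_pos
    have h3 : (δ^2 - s^2)/2 * (4*π) ≤ 2 * π * δ^2 := by nlinarith [mul_nonneg this.le (sq_nonneg s)]
    calc B * ((δ^2 - s^2)/2) * (4 * π) = B * ((δ^2 - s^2)/2 * (4*π)) := by ring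
      _ ≤ _ := mul_le_mul_of_nonneg_left h3 hB

def TT (s₁ δ a : ℝ) : ℝ := if a = -3 then Real.log (δ / s₁) else δ ^ (a + 3) / (a + 3)

def smallT (s a : ℝ) : ℝ := if -3 < a then s ^ (a + 3) / (a + 3) else 0

lemma TT_eq {s₁ s δ a : ℝ} (hs₁ : 0 < s₁) (hs : 0 < s) (hsδ : s ≤ δ) :
    (∫ r in s..δ, r ^ (a + 2)) + tauD s₁ s a = TT s₁ δ a - smallT s a := by
  have hδ : 0 < δ := hs.trans_le hsδ
  have hmem : (0:ℝ) ∉ Set.uIcc s δ := by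
    rw [Set.uIcc_of_le hsδ]; intro h; exact absurd h.1 (not_le.2 hs)
  by_cases ha : a = -3
  · subst ha
    have : ∫ r in s..δ, r ^ ((-3:ℝ) + 2) = Real.log (δ / s) := by
      rw [← integral_inv hmem]
      apply intervalIntegral.integral_congr
      intro r hr
      simp only
      rw [show (-3:ℝ)+2 = -1 by norm_num, Real.rpow_neg_one]
    rw [this]
    simp [tauD, TT, smallT]
    rw [Real.log_div hδ.ne' hs.ne', Real.log_div hs.ne' hs₁.ne', Real.log_div hδ.ne' hs₁.ne']
    ring
  · rw [integral_rpow (Or.inr ⟨fun h => ha (by linarith), hmem⟩)]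
    rw [show a + 2 + 1 = a + 3 by ring]
    simp only [tauD, TT, smallT, ha, if_false]
    rcases lt_or_gt_of_ne ha with h | h
    · rw [if_pos h, if_neg (not_lt.2 h.le)]; ring
    · rw [if_neg (not_lt.2 h.le), if_pos h]; ring

lemma smallT_tendsto (a : ℝ) : Tendsto (fun s => smallT s a) (𝓝[>] 0) (𝓝 0) := by
  unfold smallT
  split_ifs with h
  · simpa using (rpow_tendsto_zero (by linarith : 0 < a + 3)).div_const (a+3)
  · exact tendsto_const_nhds

lemma smallT_le {s δ a : ℝ} (hs : 0 < s) (hsδ : s ≤ δ) : |smallT s a| ≤ |smallT δ a| := by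
  unfold smallT
  split_ifs with h
  · rw [abs_div, abs_div]
    have : s ^ (a+3) ≤ δ ^ (a+3) := Real.rpow_le_rpow hs.le hsδ (by linarith)
    rw [abs_of_nonneg (Real.rpow_nonneg hs.le _), abs_of_nonneg (Real.rpow_nonneg (hs.le.trans hsδ) _)]
    gcongr
  · simp

/-- annulus integral plus subtraction -/
lemma ann_est' {ι : Type*} (y : E3) {s s₁ δ : ℝ} (hs₁ : 0 < s₁) (hs : 0 < s) (hsδ : s ≤ δ) (G : E3 → ℝ)
    (hG : IntegrableOn G (ann y s δ)) (I : Finset ι) (e : ι → ℝ) (h : ι → S2 → ℝ)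
    (hc : ∀ i ∈ I, Continuous (h i)) (B : ℝ) (hB : 0 ≤ B)
    (H : ∀ r, s < r → r ≤ δ → ∀ n : S2, |G (y + r • (n : E3)) - ∑ i ∈ I, r ^ (e i) * h i n| ≤ B * r⁻¹) :
    |(∫ x in ann y s δ, G x) + (∑ i ∈ I, tauD s₁ s (e i) * ∫ n, h i n ∂dOmega)
      - ∑ i ∈ I, (TT s₁ δ (e i) - smallT s (e i)) * ∫ n, h i n ∂dOmega| ≤ B * (2 * π * δ ^ 2) := by
  have := ann_est y hs hsδ G hG I e h hc B hB H
  have h2 : ∑ i ∈ I, (TT s₁ δ (e i) - smallT s (e i)) * ∫ n, h i n ∂dOmega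
     = ∑ i ∈ I, (∫ r in s..δ, r ^ (e i + 2)) * ∫ n, h i n ∂dOmega + ∑ i ∈ I, tauD s₁ s (e i) * ∫ n, h i n ∂dOmega := by
    rw [← Finset.sum_add_distrib]
    refine Finset.sum_congr rfl fun i _ => ?_
    rw [← TT_eq hs₁ hs hsδ]; ring
  rw [h2]
  convert this using 2
  ring



lemma kernel_exp (W : S2 → E3) (hW : Continuous W) (hW0 : ∀ n, W n ≠ 0) (L : ℕ) :
    ∃ (D : ℕ) (k : ℕ → C(S2 × S2, ℝ)) (C δ : ℝ), 0 ≤ C ∧ 0 < δ ∧ ∀ r : ℝ, 0 < r → r < δ → ∀ x : S2 × S2,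
      |‖r • (x.1 : E3) - W x.2‖⁻¹ - ∑ i ∈ Finset.range D, r ^ i * k i x| ≤ C * r ^ L := by
  have hfa : AnalyticAt ℝ (fun u : ℝ => (1 - u) ^ (-(1/2) : ℝ)) 0 := by
    have h1 : AnalyticAt ℝ (fun u : ℝ => Real.exp (Real.log (1 - u) * (-(1/2)))) 0 :=
      ((AnalyticAt.log (by fun_prop) (by norm_num)).mul analyticAt_const).rexp
    refine h1.congr ?_
    have : ∀ᶠ u : ℝ in 𝓝 0, u < 1 := eventually_lt_nhds one_pos
    filter_upwards [this] with u hu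
    rw [Real.rpow_def_of_pos (by linarith)]
  obtain ⟨p, hp⟩ := hfa
  have hO := hp.isBigO_sub_partialSum_pow L
  obtain ⟨C0, hC0pos, hC0⟩ := hO.exists_pos
  rw [IsBigOWith] at hC0
  obtain ⟨δ0, hδ0, hball⟩ := Metric.eventually_nhds_iff.1 hC0
  have hnw : ∀ n, ‖W n‖ ≠ 0 := fun n => norm_ne_zero_iff.2 (hW0 n)
  let a : C(S2 × S2, ℝ) := ⟨fun x => 2 * inner ℝ (x.1 : E3) (W x.2) * (‖W x.2‖^2)⁻¹, by
    refine Continuous.mul (by fun_prop) (Continuous.inv₀ (by fun_prop) (fun x => pow_ne_zero _ (hnw _)))⟩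
  let b : C(S2 × S2, ℝ) := ⟨fun x => (‖W x.2‖^2)⁻¹, 
    (Continuous.inv₀ (by fun_prop) (fun x => pow_ne_zero _ (hnw _)))⟩
  let N : C(S2 × S2, ℝ) := ⟨fun x => ‖W x.2‖⁻¹, 
    (Continuous.inv₀ (by fun_prop) (fun x => (hnw _)))⟩
  let q : Polynomial C(S2 × S2, ℝ) := Polynomial.C N * ∑ k ∈ Finset.range L,
    Polynomial.C (ContinuousMap.const _ (p.coeff k)) * (Polynomial.X * Polynomial.C a - Polynomial.X^2 * Polynomial.C b) ^ k
  have hq1 : ∀ (r : ℝ) (x : S2 × S2), (q.eval (ContinuousMap.const _ r)) x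
      = N x * ∑ k ∈ Finset.range L, p.coeff k * (r * a x - r^2 * b x) ^ k := by
    intro r x
    simp only [q, Polynomial.eval_mul, Polynomial.eval_C, Polynomial.eval_finsetSum, Polynomial.eval_pow, Polynomial.eval_sub, Polynomial.eval_X, ContinuousMap.mul_apply, ContinuousMap.sum_apply, ContinuousMap.pow_apply, ContinuousMap.sub_apply, ContinuousMap.const_apply]
  clear_value q
  have hq2 : ∀ (r : ℝ) (x : S2 × S2), (q.eval (ContinuousMap.const _ r)) x
      = ∑ i ∈ Finset.range (q.natDegree + 1), r ^ i * q.coeff i x := by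
    intro r x
    rw [Polynomial.eval_eq_sum_range, ContinuousMap.sum_apply]
    refine Finset.sum_congr rfl fun i _ => ?_
    rw [ContinuousMap.mul_apply, ContinuousMap.pow_apply, ContinuousMap.const_apply, mul_comm]
  set M := ‖a‖ + ‖b‖ with hM
  have hM0 : 0 ≤ M := by positivity
  refine ⟨q.natDegree + 1, fun i => q.coeff i, ‖N‖ * C0 * M ^ L, min (min 1 (δ0 / (M + 1))) (1/(M+1)), by positivity, by positivity, ?_⟩
  intro r hr hrδ x
  have hr1 : r < 1 := hrδ.trans_le ((min_le_left _ _).trans (min_le_left _ _))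
  have hr2 : r < δ0 / (M+1) := hrδ.trans_le ((min_le_left _ _).trans (min_le_right _ _))
  have hr3 : r < 1 / (M+1) := hrδ.trans_le (min_le_right _ _)
  rw [lt_div_iff₀ (by positivity)] at hr2 hr3
  rw [← hq2, hq1]
  set u := r * a x - r^2 * b x with hu
  have hub : |u| ≤ r * M := by
    have h1 := a.norm_coe_le_norm x
    have h2 := b.norm_coe_le_norm x
    rw [Real.norm_eq_abs] at h1 h2
    calc |u| ≤ |r * a x| + |r^2 * b x| := abs_sub _ _
      _ = r * |a x| + r^2 * |b x| := by rw [abs_mul, abs_mul, abs_of_pos hr, abs_of_pos (pow_pos hr 2)]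
      _ ≤ r * ‖a‖ + r * ‖b‖ := by
        gcongr
        nlinarith
      _ = r * M := by rw [hM]; ring
  have hu1 : |u| < 1 := by nlinarith
  have hu2 : |u| < δ0 := by nlinarith
  have hB := hball (y := u) (by simpa using hu2)
  rw [zero_add] at hB
  have hps : p.partialSum L u = ∑ k ∈ Finset.range L, p.coeff k * u ^ k := by
    simp [FormalMultilinearSeries.partialSum, mul_comm]
  rw [hps] at hB
  have hker : ‖r • (x.1 : E3) - W x.2‖⁻¹ = N x * (1 - u) ^ (-(1/2) : ℝ) := by
    have h1u : 0 ≤ 1 - u := by linarith [(abs_lt.1 hu1).2]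
    have hsq : ‖r • (x.1 : E3) - W x.2‖ ^ 2 = ‖W x.2‖ ^ 2 * (1 - u) := by
      rw [norm_sub_sq_real, norm_smul, s2_norm, inner_smul_left, Real.norm_eq_abs, mul_one, sq_abs, hu]
      simp [a, b]
      have := hnw x.2
      field_simp
      ring
    have h3 : ‖r • (x.1 : E3) - W x.2‖ = ‖W x.2‖ * Real.sqrt (1 - u) := by
      rw [← Real.sqrt_sq (norm_nonneg (r • (x.1 : E3) - W x.2)), hsq, Real.sqrt_mul (by positivity), Real.sqrt_sq (norm_nonneg _)]
    rw [h3, mul_inv, Real.rpow_neg h1u, ← Real.sqrt_eq_rpow]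
    rfl
  rw [hker, ← mul_sub, abs_mul]
  have hN := N.norm_coe_le_norm x
  rw [Real.norm_eq_abs] at hN
  calc |N x| * |(1 - u) ^ (-(1/2) : ℝ) - ∑ k ∈ Finset.range L, p.coeff k * u ^ k|
      ≤ ‖N‖ * (C0 * (r * M) ^ L) := by
        gcongr
        refine (by simpa using hB : _ ≤ C0 * |u| ^ L).trans ?_
        gcongr
    _ = _ := by rw [mul_pow]; ring

lemma coeff_cont {f : S2 → ℝ} (h : SmoothSphereFn f) : Continuous f := by
  obtain ⟨g, hg, hgf⟩ := h
  have : f = fun n : S2 => g n := by ext n; exact (hgf n).symm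
  rw [this]
  exact hg.continuous.comp continuous_subtype_val

lemma int_exp {y : E3} {F : E3 → ℝ} {c : ℝ → S2 → ℝ} (h : HasSingExpansion y F c) (hi : IntegerExponents c) :
    ∃ K0 : ℕ, ∀ ε > 0, ∃ δ > 0, ∀ r : ℝ, 0 < r → r < δ → ∀ n : S2,
      |F (y + r • (n : E3)) - ∑ k ∈ Finset.range (K0 + 4), r ^ (-(k:ℝ)) * c (-(k:ℝ)) n| ≤ ε := by
  obtain ⟨a0, ha0⟩ := h.bddBelow
  refine ⟨⌈-a0⌉₊, ?_⟩
  intro ε hε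
  obtain ⟨δ, hδ, H⟩ := h.expansion 0 ε hε
  refine ⟨δ, hδ, fun r hr hrδ n => ?_⟩
  have := H r hr hrδ n
  rw [sing_finset h] at this
  simp only [Nat.cast_zero, Real.rpow_zero, mul_one] at this
  convert this using 3
  rw [← Finset.sum_image (f := fun a => r ^ a * c a n) (g := fun k : ℕ => -(k:ℝ)) (by
    intro i _ j _ hij; simpa using hij)]
  symm
  apply Finset.sum_subset
  · intro a ha
    simp at ha
    obtain ⟨z, hz⟩ := hi a ha.2
    have hz0 : z ≤ 0 := by have := ha.1; rw [hz] at this; exact_mod_cast this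
    obtain ⟨k, hk⟩ := Int.eq_ofNat_of_zero_le (neg_nonneg.2 hz0)
    have hak : a = -(k:ℝ) := by
      rw [hz]; rw [← neg_eq_iff_eq_neg]; exact_mod_cast hk
    rw [Finset.mem_image]
    refine ⟨k, ?_, hak.symm⟩
    rw [Finset.mem_range]
    by_contra hlt
    push Not at hlt
    apply ha.2
    apply ha0
    have h1 : -a0 ≤ (⌈-a0⌉₊ : ℝ) := Nat.le_ceil _
    have h2 : ((⌈-a0⌉₊ + 4 : ℕ) : ℝ) ≤ k := by exact_mod_cast hlt
    push_cast at h2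
    rw [hak]; linarith
  · intro a ha hna
    rw [Finset.mem_image] at ha
    obtain ⟨k, -, rfl⟩ := ha
    simp at hna
    simp [hna]

lemma prod_exp {y : E3} {F : E3 → ℝ} {c : ℝ → S2 → ℝ} (hc : ∀ a, Continuous (c a)) (K : ℕ)
    (h : ∀ ε > 0, ∃ δ > 0, ∀ r : ℝ, 0 < r → r < δ → ∀ n : S2,
      |F (y + r • (n : E3)) - ∑ k ∈ Finset.range K, r ^ (-(k:ℝ)) * c (-(k:ℝ)) n| ≤ ε)
    (W : S2 → E3) (hW : Continuous W) (hW0 : ∀ n, W n ≠ 0) :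
    ∃ (I : Finset (ℕ × ℕ)) (e : ℕ × ℕ → ℝ) (g : ℕ × ℕ → C(S2 × S2, ℝ)), ∀ ε > 0, ∃ δ > 0, ∀ r : ℝ, 0 < r → r < δ → 
      ∀ x : S2 × S2,
      |F (y + r • (x.1 : E3)) * ‖r • (x.1 : E3) - W x.2‖⁻¹ - ∑ i ∈ I, r ^ (e i) * g i x| ≤ ε := by
  obtain ⟨D, k, C, δk, hC, hδk, hk⟩ := kernel_exp W hW hW0 (K + 1)
  let cc : ℝ → C(S2 × S2, ℝ) := fun a => ⟨fun x => c a x.1, (hc a).comp continuous_fst⟩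
  refine ⟨Finset.range K ×ˢ Finset.range D, fun i => -(i.1 : ℝ) + i.2, fun i => cc (-(i.1:ℝ)) * k i.2, ?_⟩
  intro ε hε
  set MK := ∑ i ∈ Finset.range D, ‖k i‖ with hMK
  set CF := 1 + ∑ j ∈ Finset.range K, ‖cc (-(j:ℝ))‖ with hCF
  have hMK0 : 0 ≤ MK := Finset.sum_nonneg fun _ _ => norm_nonneg _
  have hCF0 : 0 ≤ CF := by have := Finset.sum_nonneg (s := Finset.range K) fun j _ => norm_nonneg (cc (-(j:ℝ))); linarith
  obtain ⟨δ1, hδ1, h1⟩ := h 1 one_pos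
  obtain ⟨δ2, hδ2, h2⟩ := h (ε / (2 * (MK + 1))) (by positivity)
  refine ⟨min (min δ1 δ2) (min (min 1 δk) (ε / (2 * (CF * C + 1)))), by positivity, ?_⟩
  intro r hr hrδ x
  simp only [lt_min_iff] at hrδ
  obtain ⟨⟨hr1, hr2⟩, ⟨hr3, hr4⟩, hr5⟩ := hrδ
  have e1 : ∑ i ∈ Finset.range K ×ˢ Finset.range D, r ^ (-(i.1 : ℝ) + i.2) * (cc (-(i.1:ℝ)) * k i.2) x
      = (∑ j ∈ Finset.range K, r ^ (-(j:ℝ)) * c (-(j:ℝ)) x.1) * (∑ i ∈ Finset.range D, r ^ i * k i x) := by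
    rw [Finset.sum_mul_sum, Finset.sum_product]
    refine Finset.sum_congr rfl fun j _ => Finset.sum_congr rfl fun i _ => ?_
    rw [Real.rpow_add hr, Real.rpow_natCast]
    simp [cc]; ring
  rw [e1]
  have hF1 := h1 r hr hr1 x.1
  have hF2 := h2 r hr hr2 x.1
  have hkk := hk r hr hr4 x
  set SF := ∑ j ∈ Finset.range K, r ^ (-(j:ℝ)) * c (-(j:ℝ)) x.1
  set SK := ∑ i ∈ Finset.range D, r ^ i * k i x
  set f := F (y + r • (x.1 : E3))
  set κ := ‖r • (x.1 : E3) - W x.2‖⁻¹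
  have hSK : |SK| ≤ MK := by
    refine (Finset.abs_sum_le_sum_abs _ _).trans (Finset.sum_le_sum fun i _ => ?_)
    rw [abs_mul, abs_of_pos (pow_pos hr i)]
    have := (k i).norm_coe_le_norm x
    rw [Real.norm_eq_abs] at this
    have h3 : r ^ i ≤ 1 := pow_le_one₀ hr.le hr3.le
    calc r ^ i * |k i x| ≤ 1 * ‖k i‖ := by gcongr
      _ = _ := one_mul _
  have hone : 1 ≤ r ^ (-(K:ℝ)) := Real.one_le_rpow_of_pos_of_le_one_of_nonpos hr hr3.le (by simp)
  have hSF : |SF| ≤ (CF - 1) * r ^ (-(K:ℝ)) := by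
    rw [hCF, add_sub_cancel_left, Finset.sum_mul]
    refine (Finset.abs_sum_le_sum_abs _ _).trans (Finset.sum_le_sum fun j hj => ?_)
    rw [abs_mul, abs_of_pos (Real.rpow_pos_of_pos hr _), mul_comm]
    have := (cc (-(j:ℝ))).norm_coe_le_norm x
    rw [Real.norm_eq_abs] at this
    have h4 : r ^ (-(j:ℝ)) ≤ r ^ (-(K:ℝ)) := by
      apply Real.rpow_le_rpow_of_exponent_ge hr hr3.le
      have : j ≤ K := (Finset.mem_range.1 hj).le
      have : (j:ℝ) ≤ K := by exact_mod_cast this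
      linarith
    gcongr
    exact this
  have hf : |f| ≤ CF * r ^ (-(K:ℝ)) := by
    have : |f| ≤ |f - SF| + |SF| := by simpa using abs_add_le (f - SF) SF
    linarith
  have hid : f * κ - SF * SK = f * (κ - SK) + (f - SF) * SK := by ring
  rw [hid]
  calc |f * (κ - SK) + (f - SF) * SK| ≤ |f| * |κ - SK| + |f - SF| * |SK| := by
        rw [← abs_mul, ← abs_mul]; exact abs_add_le _ _
    _ ≤ CF * r ^ (-(K:ℝ)) * (C * r ^ (K+1)) + ε / (2 * (MK + 1)) * MK := by gcongr
    _ = CF * C * r + ε / (2 * (MK + 1)) * MK := by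
        congr 1
        rw [Real.rpow_neg hr.le, Real.rpow_natCast, pow_succ]
        field_simp
    _ ≤ ε / 2 + ε / 2 := by
        apply add_le_add
        · rw [lt_div_iff₀ (by positivity)] at hr5
          nlinarith [mul_nonneg hCF0 hC]
        · rw [div_mul_eq_mul_div, div_le_div_iff₀ (by positivity) (by positivity)]
          nlinarith
    _ = ε := by ring



def Es (y₁ y₂ : E3) (s : ℝ) : Set E3 := (Metric.closedBall y₁ s ∪ Metric.closedBall y₂ s)ᶜ

lemma mem_Es {y₁ y₂ x : E3} {s : ℝ} : x ∈ Es y₁ y₂ s ↔ s < ‖x - y₁‖ ∧ s < ‖x - y₂‖ := by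
  simp [Es, dist_eq_norm]

lemma Es_open (y₁ y₂ : E3) (s : ℝ) : IsOpen (Es y₁ y₂ s) :=
  (Metric.isClosed_closedBall.union Metric.isClosed_closedBall).isOpen_compl

lemma Es_sub {y₁ y₂ : E3} {s : ℝ} (hs : 0 ≤ s) : Es y₁ y₂ s ⊆ {y₁, y₂}ᶜ := by
  intro x hx
  rw [mem_Es] at hx
  simp only [Set.mem_compl_iff, Set.mem_insert_iff, Set.mem_singleton_iff]
  rintro (rfl | rfl)
  · have := hx.1; simp at this; linarith
  · have := hx.2; simp at this; linarith

lemma F_bound {y₁ y₂ : E3} {F : E3 → ℝ} (hF : ContinuousOn F ({y₁, y₂}ᶜ : Set E3)) {η : ℝ} (hη : 0 < η)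
    (hdecay : ∃ C R : ℝ, ∀ x : E3, R ≤ ‖x‖ → |F x| ≤ C * ‖x‖ ^ (-3 - η)) {s : ℝ} (hs : 0 < s) :
    ∃ C : ℝ, ∀ x ∈ Es y₁ y₂ s, |F x| ≤ C * (1 + ‖x‖) ^ (-(3 + η)) := by
  obtain ⟨C, R, hCR⟩ := hdecay
  set R' := max R 1
  have hK : IsCompact (Metric.closedBall (0:E3) R' ∩ {x | s ≤ ‖x - y₁‖ ∧ s ≤ ‖x - y₂‖}) := by
    apply (isCompact_closedBall _ _).inter_right
    have h1 : IsClosed {x : E3 | s ≤ ‖x - y₁‖} := isClosed_le continuous_const (by fun_prop)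
    have h2 : IsClosed {x : E3 | s ≤ ‖x - y₂‖} := isClosed_le continuous_const (by fun_prop)
    exact h1.inter h2
  obtain ⟨M, hM⟩ := hK.exists_bound_of_continuousOn (f := F) (hF.mono (by
    rintro x ⟨-, h1, h2⟩
    simp only [Set.mem_compl_iff, Set.mem_insert_iff, Set.mem_singleton_iff]
    rintro (rfl | rfl)
    · simp at h1; linarith
    · simp at h2; linarith))
  refine ⟨|C| * 2 ^ (3 + η) + |M| * (1 + R') ^ (3 + η), fun x hx => ?_⟩
  have hR' : 0 < R' := lt_of_lt_of_le one_pos (le_max_right _ _)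
  have hp : 0 < (1 + ‖x‖) ^ (-(3 + η)) := by positivity
  have hp1 : 0 < (2:ℝ) ^ (3 + η) := by positivity
  have hp2 : 0 < (1 + R') ^ (3 + η) := by positivity
  rw [mem_Es] at hx
  by_cases h : R' ≤ ‖x‖
  · have h1 := hCR x ((le_max_left _ _).trans h)
    have hx1 : 1 ≤ ‖x‖ := (le_max_right _ _).trans h
    have h2 : ‖x‖ ^ (-3 - η) ≤ 2 ^ (3 + η) * (1 + ‖x‖) ^ (-(3 + η)) := by
      have e : ‖x‖ ^ (-3 - η) = 2 ^ (3 + η) * (2 * ‖x‖) ^ (-(3 + η)) := by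
        rw [Real.mul_rpow (by norm_num) (by positivity), ← mul_assoc, ← Real.rpow_add (by norm_num)]
        simp
        congr 1; ring
      rw [e]
      gcongr ?_ * ?_
      apply Real.rpow_le_rpow_of_nonpos (by positivity) (by linarith) (by linarith)
    calc |F x| ≤ C * ‖x‖ ^ (-3 - η) := h1
      _ ≤ |C| * ‖x‖ ^ (-3 - η) := by gcongr; exact le_abs_self C
      _ ≤ |C| * (2 ^ (3 + η) * (1 + ‖x‖) ^ (-(3 + η))) := by gcongr
      _ ≤ _ := by
        have : 0 ≤ |M| * (1 + R') ^ (3 + η) * (1 + ‖x‖) ^ (-(3 + η)) := by positivity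
        nlinarith
  · push Not at h
    have h1 := hM x ⟨by simpa using h.le, hx.1.le, hx.2.le⟩
    rw [Real.norm_eq_abs] at h1
    have h2 : 1 ≤ (1 + R') ^ (3 + η) * (1 + ‖x‖) ^ (-(3 + η)) := by
      have : (1:ℝ) = (1 + R') ^ (3 + η) * (1 + R') ^ (-(3 + η)) := by
        rw [← Real.rpow_add (by positivity)]; simp
      conv_lhs => rw [this]
      gcongr ?_ * ?_
      apply Real.rpow_le_rpow_of_nonpos (by positivity) (by linarith) (by linarith)
    calc |F x| ≤ |M| * 1 := by rw [mul_one]; exact h1.trans (le_abs_self M)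
      _ ≤ |M| * ((1 + R') ^ (3 + η) * (1 + ‖x‖) ^ (-(3 + η))) := by gcongr
      _ ≤ _ := by
        have : 0 ≤ |C| * 2 ^ (3 + η) * (1 + ‖x‖) ^ (-(3 + η)) := by positivity
        nlinarith

lemma F_int {y₁ y₂ : E3} {F : E3 → ℝ} (hF : ContinuousOn F ({y₁, y₂}ᶜ : Set E3)) {η : ℝ} (hη : 0 < η)
    (hdecay : ∃ C R : ℝ, ∀ x : E3, R ≤ ‖x‖ → |F x| ≤ C * ‖x‖ ^ (-3 - η)) {s : ℝ} (hs : 0 < s) :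
    IntegrableOn F (Es y₁ y₂ s) := by
  obtain ⟨C, hC⟩ := F_bound hF hη hdecay hs
  have h1 : Integrable (fun x : E3 => C * (1 + ‖x‖) ^ (-(3 + η))) volume :=
    (integrable_one_add_norm (by simp; linarith)).const_mul C
  refine Integrable.mono' h1.integrableOn ?_ ?_
  · exact (hF.mono (Es_sub hs.le)).aestronglyMeasurable (Es_open _ _ _).measurableSet
  · filter_upwards [ae_restrict_mem (Es_open _ _ _).measurableSet] with x hx
    exact hC x hx

lemma F_int_mul {A : Set E3} (hA : MeasurableSet A) {F g : E3 → ℝ} (hF : IntegrableOn F A) (hg : Measurable g) {B : ℝ}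
    (hB : ∀ x ∈ A, |g x| ≤ B) : IntegrableOn (fun x => F x * g x) A := by
  refine Integrable.mul_bdd (c := B) hF hg.aestronglyMeasurable ?_
  filter_upwards [ae_restrict_mem hA] with x hx
  exact hB x hx

lemma sphere_ae (y : E3) (r : ℝ) (_hr : 0 < r) : ∀ᵐ x : E3, ‖x - y‖ ≠ r := by
  have : (volume : Measure E3) (Metric.sphere y r) = 0 := Measure.addHaar_sphere _ _ _
  rw [ae_iff]
  convert this using 2
  ext x; simp

lemma fub_int (y₁ : E3) {A : Set E3} {F : E3 → ℝ} (hF : IntegrableOn F A) {r' : ℝ} (hr : 0 < r') :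
    Integrable (fun z : E3 × S2 => F z.1 / ‖z.1 - (y₁ + r' • (z.2 : E3))‖) ((volume.restrict A).prod dOmega) := by
  have hmeas : AEStronglyMeasurable (fun z : E3 × S2 => F z.1 / ‖z.1 - (y₁ + r' • (z.2 : E3))‖) ((volume.restrict A).prod dOmega) := by
    have h1 : AEStronglyMeasurable (fun z : E3 × S2 => F z.1) ((volume.restrict A).prod dOmega) :=
      hF.aestronglyMeasurable.comp_fst
    have h2 : AEStronglyMeasurable (fun z : E3 × S2 => ‖z.1 - (y₁ + r' • (z.2 : E3))‖⁻¹) ((volume.restrict A).prod dOmega) := by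
      have : Continuous (fun z : E3 × S2 => ‖z.1 - (y₁ + r' • (z.2 : E3))‖) := by fun_prop
      exact this.measurable.inv.aestronglyMeasurable
    exact h1.mul h2
  rw [integrable_prod_iff hmeas]
  have hne : ∀ x : E3, ‖x - y₁‖ ≠ r' → ∀ n : S2, ‖x - (y₁ + r' • (n : E3))‖ ≠ 0 := by
    intro x hx n h
    rw [norm_eq_zero, sub_eq_zero] at h
    apply hx
    rw [h, add_sub_cancel_left, norm_smul, s2_norm, Real.norm_eq_abs, abs_of_pos hr, mul_one]
  constructor
  · filter_upwards [ae_restrict_of_ae (sphere_ae y₁ r' hr)] with x hx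
    apply s2_integrable
    refine Continuous.div continuous_const (by fun_prop) (hne x hx)
  · have h3 : IntegrableOn (fun x => |F x| * (4 * π * (max ‖x - y₁‖ r')⁻¹)) A := by
      refine Integrable.mul_bdd (c := 4 * π * r'⁻¹) hF.abs ?_ ?_
      · have : Continuous (fun x : E3 => max ‖x - y₁‖ r') := by fun_prop
        exact (this.measurable.inv.const_mul _).aestronglyMeasurable
      · refine Eventually.of_forall fun x => ?_
        have : 0 < max ‖x - y₁‖ r' := lt_max_of_lt_right hr
        rw [Real.norm_eq_abs, abs_of_pos (by positivity)]
        gcongr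
        exact le_max_right _ _
    refine h3.congr ?_
    filter_upwards [ae_restrict_of_ae (sphere_ae y₁ r' hr)] with x hx
    have := newton (x - y₁) r' hr hx
    rw [← this, ← integral_const_mul]
    refine integral_congr_ae (Eventually.of_forall fun n => ?_)
    beta_reduce
    rw [div_eq_mul_inv, norm_mul, norm_inv, norm_norm, Real.norm_eq_abs, sub_add_eq_sub_sub]

lemma fub (y₁ : E3) {A : Set E3} {F : E3 → ℝ} (hF : IntegrableOn F A) {r' : ℝ} (hr : 0 < r') :
    ∫ n : S2, (∫ x in A, F x / ‖x - (y₁ + r' • (n : E3))‖) ∂dOmega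
      = 4 * π * ∫ x in A, F x * (max ‖x - y₁‖ r')⁻¹ := by
  have h := fub_int y₁ hF hr
  rw [← integral_const_mul, ← integral_integral_swap h]
  refine integral_congr_ae ?_
  filter_upwards [ae_restrict_of_ae (sphere_ae y₁ r' hr)] with x hx
  have := newton (x - y₁) r' hr hx
  have e : 4 * π * (F x * (max ‖x - y₁‖ r')⁻¹) = F x * (4 * π * (max ‖x - y₁‖ r')⁻¹) := by ring
  rw [e, ← this, ← integral_const_mul]
  refine integral_congr_ae (Eventually.of_forall fun n => ?_)
  simp only [div_eq_mul_inv, sub_add_eq_sub_sub]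



lemma exp_to_H {f : ℝ → ℝ} (h : ∀ ε > 0, ∃ δ > 0, ∀ r : ℝ, 0 < r → r < δ → |f r| ≤ ε) :
    Tendsto f (𝓝[>] 0) (𝓝 0) := by
  rw [Metric.tendsto_nhdsWithin_nhds]
  intro ε hε
  obtain ⟨δ, hδ, H⟩ := h (ε/2) (by positivity)
  refine ⟨δ, hδ, fun {r} hr hd => ?_⟩
  rw [Set.mem_Ioi] at hr
  rw [Real.dist_eq, sub_zero] at hd ⊢
  rw [abs_of_pos hr] at hd
  linarith [H r hr hd]

lemma exp_to_H' {f : ℝ → ℝ} (h : ∀ ε > 0, ∃ δ > 0, ∀ r : ℝ, 0 < r → r < δ → |f r| ≤ ε) :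
    Tendsto (fun r => r * f r) (𝓝[>] 0) (𝓝 0) := by
  simpa using id_tendsto.mul (exp_to_H h)

lemma avg_cont (g : C(S2 × S2, ℝ)) : Continuous (fun n : S2 => ∫ n' : S2, g (n, n') ∂dOmega) := by
  have := continuous_parametric_integral_of_continuous (μ := dOmega) (f := fun n n' : S2 => g (n, n'))
    (by exact g.continuous) isCompact_univ
  simpa using this

lemma avg_cont' (g : C(S2 × S2, ℝ)) : Continuous (fun n' : S2 => ∫ n : S2, g (n, n') ∂dOmega) :=
  avg_cont (g.comp ⟨Prod.swap, continuous_swap⟩)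

lemma avg_swap (g : C(S2 × S2, ℝ)) :
    ∫ n' : S2, (∫ n : S2, g (n, n') ∂dOmega) ∂dOmega = ∫ n : S2, (∫ n' : S2, g (n, n') ∂dOmega) ∂dOmega := by
  symm
  apply integral_integral_swap
  have : Integrable g (dOmega.prod dOmega) :=
    g.continuous.integrable_of_hasCompactSupport (HasCompactSupport.of_compactSpace _)
  exact this

lemma avg_abs (g : C(S2 × S2, ℝ)) (n' : S2) : |∫ n : S2, g (n, n') ∂dOmega| ≤ 4 * π * ‖g‖ := by
  have := norm_integral_le_of_norm_le_const (μ := dOmega) (f := fun n => g (n, n')) (C := ‖g‖)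
    (Eventually.of_forall fun n => g.norm_coe_le_norm _)
  rw [dOmega_mass, mul_comm] at this
  exact this

/-- The uniform joint expansion used below. -/
def UExp (y₁ y : E3) (F : E3 → ℝ) (r' : ℝ) (I : Finset (ℕ × ℕ)) (e : ℕ × ℕ → ℝ) (g : ℕ × ℕ → C(S2 × S2, ℝ)) : Prop :=
  ∀ ε > 0, ∃ δ > 0, ∀ r : ℝ, 0 < r → r < δ → ∀ n n' : S2,
    |F (y + r • (n : E3)) / ‖y + r • (n : E3) - (y₁ + r' • (n' : E3))‖ - ∑ i ∈ I, r ^ (e i) * g i (n, n')| ≤ ε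

lemma point_data (y₁ y : E3) {F : E3 → ℝ} {c : ℝ → S2 → ℝ} (h : HasSingExpansion y F c) (hi : IntegerExponents c)
    {r' : ℝ} (hr' : 0 < r') (hne : ‖y - y₁‖ ≠ r') :
    ∃ I e g, UExp y₁ y F r' I e g := by
  obtain ⟨K0, hK⟩ := int_exp h hi
  obtain ⟨I, e, g, H⟩ := prod_exp (fun a => coeff_cont (h.smooth_coeffs a)) _ hK
    (fun n' : S2 => y₁ + r' • (n' : E3) - y) (by fun_prop) (by
      intro n h0
      apply hne
      rw [sub_eq_zero] at h0
      rw [← h0, add_sub_cancel_left, norm_smul, s2_norm, Real.norm_eq_abs, abs_of_pos hr', mul_one])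
  refine ⟨I, e, g, fun ε hε => ?_⟩
  obtain ⟨δ, hδ, H⟩ := H ε hε
  refine ⟨δ, hδ, fun r hr hrδ n n' => ?_⟩
  have := H r hr hrδ (n, n')
  have e0 : y + r • (n : E3) - (y₁ + r' • (n' : E3)) = r • (n : E3) - (y₁ + r' • (n' : E3) - y) := by abel
  rw [div_eq_mul_inv, e0]
  exact this

lemma point_avg {y₁ y : E3} {F : E3 → ℝ} {r' : ℝ} (hr' : 0 < r') (hne : ‖y - y₁‖ ≠ r')
    {I : Finset (ℕ × ℕ)} {e : ℕ × ℕ → ℝ} {g : ℕ × ℕ → C(S2 × S2, ℝ)} (H : UExp y₁ y F r' I e g) :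
    ∀ ε > 0, ∃ δ > 0, ∀ r : ℝ, 0 < r → r < δ → ∀ n : S2,
    |F (y + r • (n : E3)) * (max ‖y + r • (n : E3) - y₁‖ r')⁻¹
      - ∑ i ∈ I, r ^ (e i) * ((4 * π)⁻¹ * ∫ n', g i (n, n') ∂dOmega)| ≤ ε := by
  intro ε hε
  obtain ⟨δ, hδ, H⟩ := H ε hε
  have hd : 0 < |‖y - y₁‖ - r'| := abs_pos.2 (sub_ne_zero.2 hne)
  refine ⟨min δ |‖y - y₁‖ - r'|, by positivity, fun r hr hrδ n => ?_⟩
  rw [lt_min_iff] at hrδ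
  set x := y + r • (n : E3) with hx
  have hxne : ‖x - y₁‖ ≠ r' := by
    intro h0
    have h1 : |‖y - y₁‖ - ‖x - y₁‖| ≤ ‖(y - y₁) - (x - y₁)‖ := abs_norm_sub_norm_le _ _
    have h2 : (y - y₁) - (x - y₁) = -(r • (n : E3)) := by rw [hx]; abel
    rw [h2, norm_neg, norm_smul, s2_norm, Real.norm_eq_abs, abs_of_pos hr, mul_one, h0] at h1
    linarith [hrδ.2]
  have hN := newton (x - y₁) r' hr' hxne
  have hk : ∀ n' : S2, ‖x - (y₁ + r' • (n' : E3))‖ ≠ 0 := by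
    intro n' h0
    rw [norm_eq_zero, sub_eq_zero] at h0
    apply hxne
    rw [h0, add_sub_cancel_left, norm_smul, s2_norm, Real.norm_eq_abs, abs_of_pos hr', mul_one]
  have e1 : ∫ n' : S2, (F x / ‖x - (y₁ + r' • (n' : E3))‖ - ∑ i ∈ I, r ^ (e i) * g i (n, n')) ∂dOmega
      = 4 * π * (F x * (max ‖x - y₁‖ r')⁻¹ - ∑ i ∈ I, r ^ (e i) * ((4 * π)⁻¹ * ∫ n', g i (n, n') ∂dOmega)) := by
    rw [integral_sub, integral_finsetSum]
    · simp only [integral_const_mul, div_eq_mul_inv, sub_add_eq_sub_sub, hN]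
      rw [mul_sub, Finset.mul_sum]
      congr 1
      · ring
      · refine Finset.sum_congr rfl fun i _ => ?_
        field_simp
    · intro i _
      exact s2_integrable (by fun_prop)
    · exact s2_integrable (Continuous.div continuous_const (by fun_prop) hk)
    · exact s2_integrable (by fun_prop)
  have h3 := norm_integral_le_of_norm_le_const (μ := dOmega)
    (f := fun n' : S2 => F x / ‖x - (y₁ + r' • (n' : E3))‖ - ∑ i ∈ I, r ^ (e i) * g i (n, n')) (C := ε)
    (Eventually.of_forall fun n' => H r hr hrδ.1 n n')
  rw [dOmega_mass, e1, norm_mul, Real.norm_eq_abs, Real.norm_eq_abs, abs_of_pos (by positivity : 0 < 4 * π), mul_comm ε] at h3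
  exact le_of_mul_le_mul_left h3 (by positivity)

lemma ann_bound {y₁ y : E3} {F : E3 → ℝ} {r' s₁ : ℝ} (hs₁ : 0 < s₁) 
    {I : Finset (ℕ × ℕ)} {e : ℕ × ℕ → ℝ} {g : ℕ × ℕ → C(S2 × S2, ℝ)} {δ : ℝ} (hδ1 : δ ≤ 1)
    (H : ∀ r : ℝ, 0 < r → r ≤ δ → ∀ n n' : S2,
      |F (y + r • (n : E3)) / ‖y + r • (n : E3) - (y₁ + r' • (n' : E3))‖ - ∑ i ∈ I, r ^ (e i) * g i (n, n')| ≤ 1) 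
    {s : ℝ} (hs : 0 < s) (hsδ : s ≤ δ) (n' : S2)
    (hIntg : IntegrableOn (fun x => F x / ‖x - (y₁ + r' • (n' : E3))‖) (ann y s δ)) :
    |(∫ x in ann y s δ, F x / ‖x - (y₁ + r' • (n' : E3))‖) + ∑ i ∈ I, tauD s₁ s (e i) * ∫ n, g i (n, n') ∂dOmega|
      ≤ 2 * π + ∑ i ∈ I, (|TT s₁ δ (e i)| + |smallT δ (e i)|) * (4 * π * ‖g i‖) := by
  have hδ : 0 < δ := hs.trans_le hsδ
  have h1 := ann_est' y hs₁ hs hsδ _ hIntg I e (fun i n => g i (n, n')) (fun i _ => by fun_prop) 1 zero_le_one (by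
    intro r hr hrδ n
    refine (H r (hs.trans hr) hrδ n n').trans ?_
    rw [one_mul]
    exact (one_le_inv₀ (hs.trans hr)).2 (hrδ.trans hδ1))
  have h2 : |∑ i ∈ I, (TT s₁ δ (e i) - smallT s (e i)) * ∫ n, g i (n, n') ∂dOmega| 
      ≤ ∑ i ∈ I, (|TT s₁ δ (e i)| + |smallT δ (e i)|) * (4 * π * ‖g i‖) := by
    refine (Finset.abs_sum_le_sum_abs _ _).trans (Finset.sum_le_sum fun i _ => ?_)
    rw [abs_mul]
    gcongr
    · exact (abs_sub _ _).trans (by gcongr 1; exact smallT_le hs hsδ)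
    · exact avg_abs _ _
  have h3 : 1 * (2 * π * δ ^ 2) ≤ 2 * π := by
    have : δ ^ 2 ≤ 1 := pow_le_one₀ hδ.le hδ1
    nlinarith [Real.pi_pos]
  have h4 := abs_sub_abs_le_abs_sub ((∫ x in ann y s δ, F x / ‖x - (y₁ + r' • (n' : E3))‖) + ∑ i ∈ I, tauD s₁ s (e i) * ∫ n, g i (n, n') ∂dOmega) 
    (∑ i ∈ I, (TT s₁ δ (e i) - smallT s (e i)) * ∫ n, g i (n, n') ∂dOmega)
  linarith

lemma Es_split_int {y₁ y₂ : E3} {s δ : ℝ} (hsδ : s ≤ δ) (hδ : 2 * δ < ‖y₁ - y₂‖) {G : E3 → ℝ}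
    (hG : IntegrableOn G (Es y₁ y₂ s)) :
    IntegrableOn G (Es y₁ y₂ δ) ∧ IntegrableOn G (ann y₁ s δ) ∧ IntegrableOn G (ann y₂ s δ) ∧
    ∫ x in Es y₁ y₂ s, G x = (∫ x in Es y₁ y₂ δ, G x) + (∫ x in ann y₁ s δ, G x) + ∫ x in ann y₂ s δ, G x := by
  have tri : ∀ x, ‖y₁ - y₂‖ ≤ ‖x - y₁‖ + ‖x - y₂‖ := by
    intro x
    have := norm_sub_le (x - y₂) (x - y₁)
    rw [sub_sub_sub_cancel_left] at this
    linarith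
  have e : Es y₁ y₂ s = Es y₁ y₂ δ ∪ ann y₁ s δ ∪ ann y₂ s δ := by
    ext x
    simp only [Set.mem_union, mem_Es, mem_ann]
    have := tri x
    constructor
    · rintro ⟨h1, h2⟩
      by_cases h3 : ‖x - y₁‖ ≤ δ
      · exact Or.inl (Or.inr ⟨h1, h3⟩)
      · by_cases h4 : ‖x - y₂‖ ≤ δ
        · exact Or.inr ⟨h2, h4⟩
        · push Not at h3 h4
          exact Or.inl (Or.inl ⟨h3, h4⟩)
    · rintro ((⟨h1, h2⟩ | ⟨h1, h2⟩) | ⟨h1, h2⟩) <;> constructor <;> linarith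
  have d1 : Disjoint (Es y₁ y₂ δ) (ann y₁ s δ) := by
    rw [Set.disjoint_left]
    intro x hx hx'
    rw [mem_Es] at hx; rw [mem_ann] at hx'
    linarith [hx.1, hx'.2]
  have d2 : Disjoint (Es y₁ y₂ δ ∪ ann y₁ s δ) (ann y₂ s δ) := by
    rw [Set.disjoint_left]
    intro x hx hx'
    rw [Set.mem_union, mem_Es, mem_ann] at hx; rw [mem_ann] at hx'
    have := tri x
    rcases hx with hx | hx
    · linarith [hx.2, hx'.2]
    · linarith [hx.2, hx'.2]
  have i1 : IntegrableOn G (Es y₁ y₂ δ) := hG.mono_set (by rw [e]; intro x hx; exact Or.inl (Or.inl hx))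
  have i2 : IntegrableOn G (ann y₁ s δ) := hG.mono_set (by rw [e]; intro x hx; exact Or.inl (Or.inr hx))
  have i3 : IntegrableOn G (ann y₂ s δ) := hG.mono_set (by rw [e]; intro x hx; exact Or.inr hx)
  refine ⟨i1, i2, i3, ?_⟩
  rw [e, setIntegral_union d2 (ann_meas _ _ _) (i1.union i2) i3, setIntegral_union d1 (ann_meas _ _ _) i1 i2]



def QQ (y₁ y₂ : E3) (s₁ s₂ : ℝ) (F : E3 → ℝ) (r' : ℝ) (I1 I2 : Finset (ℕ × ℕ)) (e1 e2 : ℕ × ℕ → ℝ) 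
   (g1 g2 : ℕ × ℕ → C(S2 × S2, ℝ)) (s : ℝ) (n' : S2) : ℝ :=
   (∫ x in Es y₁ y₂ s, F x / ‖x - (y₁ + r' • (n' : E3))‖) 
     + (∑ i ∈ I1, tauD s₁ s (e1 i) * ∫ n, g1 i (n, n') ∂dOmega)
     + (∑ i ∈ I2, tauD s₂ s (e2 i) * ∫ n, g2 i (n, n') ∂dOmega)

lemma avg_lim (y₁ y₂ : E3) (hy : y₁ ≠ y₂) (s₁ s₂ : ℝ) (hs₁ : 0 < s₁) (hs₂ : 0 < s₂)
    (F : E3 → ℝ) (hI : ∀ s : ℝ, 0 < s → IntegrableOn F (Es y₁ y₂ s)) (r' : ℝ) (hr' : 0 < r')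
    (I1 I2 : Finset (ℕ × ℕ)) (e1 e2 : ℕ × ℕ → ℝ) (g1 g2 : ℕ × ℕ → C(S2 × S2, ℝ))
    (H1 : UExp y₁ y₁ F r' I1 e1 g1) (H2 : UExp y₁ y₂ F r' I2 e2 g2) (L : S2 → ℝ)
    (hL : ∀ n' : S2, Tendsto (fun s => QQ y₁ y₂ s₁ s₂ F r' I1 I2 e1 e2 g1 g2 s n') (𝓝[>] 0) (𝓝 (L n'))) :
    Tendsto (fun s => 4 * π * (∫ x in Es y₁ y₂ s, F x * (max ‖x - y₁‖ r')⁻¹) 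
     + (∑ i ∈ I1, tauD s₁ s (e1 i) * ∫ n, (∫ n', g1 i (n, n') ∂dOmega) ∂dOmega)
     + (∑ i ∈ I2, tauD s₂ s (e2 i) * ∫ n, (∫ n', g2 i (n, n') ∂dOmega) ∂dOmega)) (𝓝[>] 0) (𝓝 (∫ n', L n' ∂dOmega)) := by
  obtain ⟨δ1, hδ1, H1⟩ := H1 1 one_pos
  obtain ⟨δ2, hδ2, H2⟩ := H2 1 one_pos
  have hyy : 0 < ‖y₁ - y₂‖ := norm_pos_iff.2 (sub_ne_zero.2 hy)
  obtain ⟨δ, hδ, hδm⟩ := exists_between (show 0 < min (min δ1 δ2) (min 1 (‖y₁ - y₂‖ / 2)) by positivity)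
  simp only [lt_min_iff] at hδm
  obtain ⟨⟨hd1, hd2⟩, hd3, hd4⟩ := hδm
  have hcs1 : ∀ s, Continuous fun n' : S2 => ∑ i ∈ I1, tauD s₁ s (e1 i) * ∫ n, g1 i (n, n') ∂dOmega := fun s =>
    continuous_finsetSum _ fun i _ => continuous_const.mul (avg_cont' _)
  have hcs2 : ∀ s, Continuous fun n' : S2 => ∑ i ∈ I2, tauD s₂ s (e2 i) * ∫ n, g2 i (n, n') ∂dOmega := fun s =>
    continuous_finsetSum _ fun i _ => continuous_const.mul (avg_cont' _)
  have hpos : ∀ᶠ s : ℝ in 𝓝[>] 0, 0 < s ∧ s ≤ δ := by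
    filter_upwards [Ioc_mem_nhdsGT hδ] with s hs using hs
  have key := tendsto_integral_filter_of_dominated_convergence (μ := dOmega) (l := 𝓝[>] (0:ℝ))
    (F := fun s n' => QQ y₁ y₂ s₁ s₂ F r' I1 I2 e1 e2 g1 g2 s n') (f := L)
    (fun n' => (∫ x in Es y₁ y₂ δ, ‖F x / ‖x - (y₁ + r' • (n' : E3))‖‖) 
      + (2 * π + ∑ i ∈ I1, (|TT s₁ δ (e1 i)| + |smallT δ (e1 i)|) * (4 * π * ‖g1 i‖))
      + (2 * π + ∑ i ∈ I2, (|TT s₂ δ (e2 i)| + |smallT δ (e2 i)|) * (4 * π * ‖g2 i‖)))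
    ?_ ?_ ?_ (Eventually.of_forall hL)
  · refine key.congr' ?_
    filter_upwards [hpos] with s hs
    have hf := (fub_int y₁ (hI s hs.1) hr').integral_prod_right
    unfold QQ
    rw [integral_add, integral_add, fub y₁ (hI s hs.1) hr', integral_finsetSum, integral_finsetSum]
    · simp only [integral_const_mul, avg_swap]
    · intro i _; exact s2_integrable (continuous_const.mul (avg_cont' _))
    · intro i _; exact s2_integrable (continuous_const.mul (avg_cont' _))
    · exact hf
    · exact s2_integrable (hcs1 s)
    · exact hf.add (s2_integrable (hcs1 s))
    · exact s2_integrable (hcs2 s)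
  · filter_upwards [hpos] with s hs
    have hf := (fub_int y₁ (hI s hs.1) hr').integral_prod_right
    exact ((hf.add (s2_integrable (hcs1 s))).add (s2_integrable (hcs2 s))).aestronglyMeasurable
  · filter_upwards [hpos] with s hs
    have hae := (fub_int y₁ (hI s hs.1) hr').prod_left_ae
    filter_upwards [hae] with n' hn'
    obtain ⟨i1, i2, i3, e⟩ := Es_split_int hs.2 (by linarith) hn'
    have b1 := ann_bound (y₁ := y₁) (y := y₁) (F := F) (r' := r') hs₁ hd3.le
      (fun r hr hrδ n n' => H1 r hr (hrδ.trans_lt hd1) n n') hs.1 hs.2 n' i2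
    have b2 := ann_bound (y₁ := y₁) (y := y₂) (F := F) (r' := r') hs₂ hd3.le
      (fun r hr hrδ n n' => H2 r hr (hrδ.trans_lt hd2) n n') hs.1 hs.2 n' i3
    have b0 := norm_integral_le_integral_norm (μ := volume.restrict (Es y₁ y₂ δ)) (fun x => F x / ‖x - (y₁ + r' • (n' : E3))‖)
    rw [Real.norm_eq_abs] at b0 ⊢
    unfold QQ
    rw [e]
    rw [abs_le] at b0 b1 b2 ⊢
    constructor <;> linarith [b0.1, b0.2, b1.1, b1.2, b2.1, b2.2]
  · have hf := (fub_int y₁ (hI δ hδ) hr').norm.integral_prod_right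
    exact (hf.add (integrable_const _)).add (integrable_const _)

lemma avg_main (y₁ y₂ : E3) (hy : y₁ ≠ y₂) (s₁ s₂ : ℝ) (hs₁ : 0 < s₁) (hs₂ : 0 < s₂)
    (F : E3 → ℝ) (c d : ℝ → S2 → ℝ) (hF : MemF y₁ y₂ F c d)
    (hci : IntegerExponents c) (hdi : IntegerExponents d)
    (hI : ∀ s : ℝ, 0 < s → IntegrableOn F (Es y₁ y₂ s)) 
    (P : E3 → ℝ)
    (hP : ∀ x' : E3, x' ≠ y₁ → x' ≠ y₂ →
      ∃ p q : ℝ → S2 → ℝ,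
        HasSingExpansion y₁ (fun x => F x / ‖x - x'‖) p
        ∧ HasSingExpansion y₂ (fun x => F x / ‖x - x'‖) q
        ∧ HasPfIntegral y₁ y₂ s₁ s₂ (fun x => F x / ‖x - x'‖) p q (-(4 * π) * P x'))
    (q0 : ℝ → S2 → ℝ) (hq0 : HasSingExpansion y₂ (fun x => F x / ‖x - y₁‖) q0)
    (r' : ℝ) (hr' : 0 < r') (hr2 : r' < ‖y₁ - y₂‖) :
    Tendsto (fun s => (∫ x in Es y₁ y₂ s, F x * (max ‖x - y₁‖ r')⁻¹) + r'⁻¹ * Dv c s₁ s + Dv q0 s₂ s) (𝓝[>] 0)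
      (𝓝 (-∫ n', P (y₁ + r' • (n' : E3)) ∂dOmega)) := by
  have hne1 : ‖y₁ - y₁‖ ≠ r' := by simpa using hr'.ne
  have hne2 : ‖y₂ - y₁‖ ≠ r' := by rw [norm_sub_rev]; exact hr2.ne'
  obtain ⟨I1, e1, g1, H1⟩ := point_data y₁ y₁ hF.exp₁ hci hr' hne1
  obtain ⟨I2, e2, g2, H2⟩ := point_data y₁ y₂ hF.exp₂ hdi hr' hne2
  have hL : ∀ n' : S2, Tendsto (fun s => QQ y₁ y₂ s₁ s₂ F r' I1 I2 e1 e2 g1 g2 s n') (𝓝[>] 0)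
      (𝓝 (-(4 * π) * P (y₁ + r' • (n' : E3)))) := by
    intro n'
    have hn : ‖y₁ + r' • (n' : E3) - y₁‖ = r' := by
      rw [add_sub_cancel_left, norm_smul, s2_norm, Real.norm_eq_abs, abs_of_pos hr', mul_one]
    obtain ⟨p, q, hp, hq, hpf⟩ := hP (y₁ + r' • (n' : E3)) (by
      intro h; rw [h] at hn; exact hne1 hn) (by
      intro h; rw [h] at hn; exact hne2 hn)
    refine hpf.congr fun s => ?_
    rw [pfApprox_eq, Dv_eq hp I1 e1 (fun i n => g1 i (n, n')) (fun i _ => by fun_prop) (fun n => exp_to_H' fun ε hε => by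
      obtain ⟨δ, hδ, h⟩ := H1 ε hε
      exact ⟨δ, hδ, fun r hr hrδ => h r hr hrδ n n'⟩),
      Dv_eq hq I2 e2 (fun i n => g2 i (n, n')) (fun i _ => by fun_prop) (fun n => exp_to_H' fun ε hε => by
      obtain ⟨δ, hδ, h⟩ := H2 ε hε
      exact ⟨δ, hδ, fun r hr hrδ => h r hr hrδ n n'⟩)]
    rfl
  have key := avg_lim y₁ y₂ hy s₁ s₂ hs₁ hs₂ F hI r' hr' I1 I2 e1 e2 g1 g2 H1 H2 _ hL
  rw [integral_const_mul] at key
  have key2 := key.const_mul (4 * π)⁻¹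
  have e : (4 * π)⁻¹ * (-(4 * π) * ∫ n' : S2, P (y₁ + r' • (n' : E3)) ∂dOmega) = -∫ n' : S2, P (y₁ + r' • (n' : E3)) ∂dOmega := by
    field_simp
  rw [e] at key2
  refine key2.congr fun s => ?_
  have A1 := point_avg hr' hne1 H1
  have A2 := point_avg hr' hne2 H2
  rw [Dv_eq hF.exp₁ I1 e1 (fun i n => r' * ((4 * π)⁻¹ * ∫ n', g1 i (n, n') ∂dOmega))
      (fun i _ => continuous_const.mul (continuous_const.mul (avg_cont _))) (fun n => by
      have h1 : Tendsto (fun r : ℝ => r' * (r * (F (y₁ + r • (n : E3)) * (max ‖y₁ + r • (n : E3) - y₁‖ r')⁻¹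
          - ∑ i ∈ I1, r ^ (e1 i) * ((4 * π)⁻¹ * ∫ n', g1 i (n, n') ∂dOmega)))) (𝓝[>] 0) (𝓝 (r' * 0)) := by
        refine Tendsto.const_mul _ (exp_to_H' fun ε hε => ?_)
        obtain ⟨δ, hδ, h⟩ := A1 ε hε
        exact ⟨δ, hδ, fun r hr hrδ => h r hr hrδ n⟩
      rw [mul_zero] at h1
      refine h1.congr' ?_
      filter_upwards [Ioo_mem_nhdsGT hr'] with r hr
      have : max ‖y₁ + r • (n : E3) - y₁‖ r' = r' := by
        rw [add_sub_cancel_left, norm_smul, s2_norm, Real.norm_eq_abs, abs_of_pos hr.1, mul_one]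
        exact max_eq_right hr.2.le
      rw [this]
      have e5 : ∑ i ∈ I1, r ^ (e1 i) * (r' * ((4 * π)⁻¹ * ∫ n', g1 i (n, n') ∂dOmega)) 
          = r' * ∑ i ∈ I1, r ^ (e1 i) * ((4 * π)⁻¹ * ∫ n', g1 i (n, n') ∂dOmega) := by
        rw [Finset.mul_sum]; exact Finset.sum_congr rfl fun i _ => by ring
      rw [e5]
      generalize ∑ i ∈ I1, r ^ (e1 i) * ((4 * π)⁻¹ * ∫ n', g1 i (n, n') ∂dOmega) = Z
      field_simp),
    Dv_eq hq0 I2 e2 (fun i n => ((4 * π)⁻¹ * ∫ n', g2 i (n, n') ∂dOmega))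
      (fun i _ => continuous_const.mul (avg_cont _)) (fun n => by
      have h1 : Tendsto (fun r : ℝ => (r * (F (y₂ + r • (n : E3)) * (max ‖y₂ + r • (n : E3) - y₁‖ r')⁻¹
          - ∑ i ∈ I2, r ^ (e2 i) * ((4 * π)⁻¹ * ∫ n', g2 i (n, n') ∂dOmega)))) (𝓝[>] 0) (𝓝 0) := by
        refine (exp_to_H' fun ε hε => ?_)
        obtain ⟨δ, hδ, h⟩ := A2 ε hε
        exact ⟨δ, hδ, fun r hr hrδ => h r hr hrδ n⟩
      refine h1.congr' ?_
      filter_upwards [Ioo_mem_nhdsGT (sub_pos.2 hr2)] with r hr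
      have : max ‖y₂ + r • (n : E3) - y₁‖ r' = ‖y₂ + r • (n : E3) - y₁‖ := by
        apply max_eq_left
        have h3 := norm_sub_norm_le (y₁ - y₂) (r • (n : E3))
        rw [norm_smul, s2_norm, Real.norm_eq_abs, abs_of_pos hr.1, mul_one] at h3
        have h4 : ‖y₂ + r • (n : E3) - y₁‖ = ‖y₁ - y₂ - r • (n : E3)‖ := by
          rw [← norm_neg]; congr 1; abel
        rw [h4]; linarith [hr.2]
      rw [this, div_eq_mul_inv])]
  simp only [integral_const_mul]
  rw [mul_add, mul_add, Finset.mul_sum, Finset.mul_sum, Finset.mul_sum]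
  congr 1
  · congr 1
    · field_simp
    · exact Finset.sum_congr rfl fun i _ => by field_simp
  · exact Finset.sum_congr rfl fun i _ => by ring



lemma diff_est (y₁ y₂ : E3) (hy : y₁ ≠ y₂) (s₁ s₂ : ℝ) (hs₁ : 0 < s₁) (hs₂ : 0 < s₂)
    (F : E3 → ℝ) (c d : ℝ → S2 → ℝ) (hF : MemF y₁ y₂ F c d)
    (hci : IntegerExponents c) (hdi : IntegerExponents d)
    (hI : ∀ s : ℝ, 0 < s → IntegrableOn F (Es y₁ y₂ s)) 
    (P : E3 → ℝ)
    (hP : ∀ x' : E3, x' ≠ y₁ → x' ≠ y₂ →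
      ∃ p q : ℝ → S2 → ℝ,
        HasSingExpansion y₁ (fun x => F x / ‖x - x'‖) p
        ∧ HasSingExpansion y₂ (fun x => F x / ‖x - x'‖) q
        ∧ HasPfIntegral y₁ y₂ s₁ s₂ (fun x => F x / ‖x - x'‖) p q (-(4 * π) * P x'))
    (Py₁ : ℝ)
    (hPy₁ : ∃ p q : ℝ → S2 → ℝ,
        HasSingExpansion y₁ (fun x => F x / ‖x - y₁‖) p
        ∧ HasSingExpansion y₂ (fun x => F x / ‖x - y₁‖) q
        ∧ HasPfIntegral y₁ y₂ s₁ s₂ (fun x => F x / ‖x - y₁‖) p q (-(4 * π) * Py₁)) :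
    ∃ K0 : ℕ, ∃ δ > 0, ∀ r' : ℝ, 0 < r' → r' < δ → 
      |(-(∫ n' : S2, P (y₁ + r' • (n' : E3)) ∂dOmega) - (-(4 * π) * Py₁))
        - ∑ k ∈ Finset.range (K0 + 4), (TT s₁ r' (-(k:ℝ)) * r'⁻¹ - TT s₁ r' (-(k:ℝ) - 1)) * ∫ n, c (-(k:ℝ)) n ∂dOmega| 
        ≤ 4 * π * r' ^ 2 := by
  obtain ⟨p0, q0, hp0, hq0, hpf⟩ := hPy₁
  obtain ⟨K0, hK⟩ := int_exp hF.exp₁ hci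
  have hyy : 0 < ‖y₁ - y₂‖ := norm_pos_iff.2 (sub_ne_zero.2 hy)
  obtain ⟨δ, hδ, hexp⟩ := hK 1 one_pos
  have hcc : ∀ a, Continuous (c a) := fun a => coeff_cont (hF.exp₁.smooth_coeffs a)
  have nrm : ∀ r : ℝ, 0 < r → ∀ n : S2, ‖y₁ + r • (n : E3) - y₁‖ = r := by
    intro r hr n
    rw [add_sub_cancel_left, norm_smul, s2_norm, Real.norm_eq_abs, abs_of_pos hr, mul_one]
  have quot : ∀ r : ℝ, 0 < r → ∀ n : S2, F (y₁ + r • (n : E3)) / ‖y₁ + r • (n : E3) - y₁‖ 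
      - ∑ k ∈ Finset.range (K0 + 4), r ^ (-(k:ℝ) - 1) * c (-(k:ℝ)) n
      = r⁻¹ * (F (y₁ + r • (n : E3)) - ∑ k ∈ Finset.range (K0 + 4), r ^ (-(k:ℝ)) * c (-(k:ℝ)) n) := by
    intro r hr n
    rw [nrm r hr n, mul_sub, Finset.mul_sum]
    congr 1
    · rw [div_eq_mul_inv, mul_comm]
    · refine Finset.sum_congr rfl fun k _ => ?_
      rw [Real.rpow_sub_one hr.ne']; ring
  have D1 : ∀ s, Dv c s₁ s = ∑ k ∈ Finset.range (K0 + 4), tauD s₁ s (-(k:ℝ)) * ∫ n, c (-(k:ℝ)) n ∂dOmega := fun s =>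
    Dv_eq hF.exp₁ (Finset.range (K0+4)) (fun k : ℕ => -(k:ℝ)) (fun k : ℕ => c (-(k:ℝ))) (fun k _ => hcc _)
      (fun n => exp_to_H' fun ε hε => by
        obtain ⟨δ, hδ, h⟩ := hK ε hε
        exact ⟨δ, hδ, fun r hr hrδ => h r hr hrδ n⟩) s₁ s
  have D2 : ∀ s, Dv p0 s₁ s = ∑ k ∈ Finset.range (K0 + 4), tauD s₁ s (-(k:ℝ) - 1) * ∫ n, c (-(k:ℝ)) n ∂dOmega := fun s =>
    Dv_eq hp0 (Finset.range (K0+4)) (fun k : ℕ => -(k:ℝ) - 1) (fun k : ℕ => c (-(k:ℝ))) (fun k _ => hcc _)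
      (fun n => by
        have h1 := exp_to_H (f := fun r : ℝ => F (y₁ + r • (n : E3)) - ∑ k ∈ Finset.range (K0 + 4), r ^ (-(k:ℝ)) * c (-(k:ℝ)) n) (fun ε hε => by
          obtain ⟨δ, hδ, h⟩ := hK ε hε
          exact ⟨δ, hδ, fun r hr hrδ => h r hr hrδ n⟩)
        refine h1.congr' ?_
        filter_upwards [self_mem_nhdsWithin] with r hr
        rw [Set.mem_Ioi] at hr
        rw [quot r hr n, mul_inv_cancel_left₀ hr.ne']) s₁ s
  refine ⟨K0, min δ (‖y₁ - y₂‖ / 2), by positivity, fun r' hr' hlt => ?_⟩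
  rw [lt_min_iff] at hlt
  have h2 : 2 * r' < ‖y₁ - y₂‖ := by linarith [hlt.2]
  have lim1 := avg_main y₁ y₂ hy s₁ s₂ hs₁ hs₂ F c d hF hci hdi hI P hP q0 hq0 r' hr' (by linarith)
  have lim := lim1.sub hpf
  have limS : Tendsto (fun s => ∑ k ∈ Finset.range (K0 + 4), ((TT s₁ r' (-(k:ℝ)) - smallT s (-(k:ℝ))) * r'⁻¹ 
      - (TT s₁ r' (-(k:ℝ) - 1) - smallT s (-(k:ℝ) - 1))) * ∫ n, c (-(k:ℝ)) n ∂dOmega) (𝓝[>] 0)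
      (𝓝 (∑ k ∈ Finset.range (K0 + 4), ((TT s₁ r' (-(k:ℝ)) - 0) * r'⁻¹ - (TT s₁ r' (-(k:ℝ) - 1) - 0)) * ∫ n, c (-(k:ℝ)) n ∂dOmega)) := by
    refine tendsto_finsetSum _ fun k _ => ?_
    exact (((tendsto_const_nhds.sub (smallT_tendsto _)).mul_const _).sub (tendsto_const_nhds.sub (smallT_tendsto _))).mul_const _
  simp only [sub_zero] at limS
  refine le_of_tendsto (lim.sub limS).abs ?_
  filter_upwards [Ioo_mem_nhdsGT hr'] with s hs
  have hmax : Measurable (fun x : E3 => (max ‖x - y₁‖ r')⁻¹) := by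
    have : Continuous (fun x : E3 => max ‖x - y₁‖ r') := by fun_prop
    exact this.measurable.inv
  have int1 : IntegrableOn (fun x => F x * (max ‖x - y₁‖ r')⁻¹) (Es y₁ y₂ s) :=
    F_int_mul (Es_open _ _ _).measurableSet (hI s hs.1) hmax (B := r'⁻¹) (fun x _ => by
      have : 0 < max ‖x - y₁‖ r' := lt_max_of_lt_right hr'
      rw [abs_of_pos (by positivity)]
      gcongr
      exact le_max_right _ _)
  have int2 : IntegrableOn (fun x => F x / ‖x - y₁‖) (Es y₁ y₂ s) := by
    simp only [div_eq_mul_inv]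
    refine F_int_mul (Es_open _ _ _).measurableSet (hI s hs.1) (by fun_prop) (B := s⁻¹) (fun x hx => ?_)
    rw [mem_Es] at hx
    rw [abs_of_nonneg (by positivity)]
    exact inv_anti₀ hs.1 hx.1.le
  obtain ⟨-, -, -, sp1⟩ := Es_split_int hs.2.le h2 int1
  obtain ⟨-, ia2, -, sp2⟩ := Es_split_int hs.2.le h2 int2
  obtain ⟨-, ia, -, -⟩ := Es_split_int hs.2.le h2 (hI s hs.1)
  have E1 : ∫ x in Es y₁ y₂ r', F x * (max ‖x - y₁‖ r')⁻¹ = ∫ x in Es y₁ y₂ r', F x / ‖x - y₁‖ := by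
    refine setIntegral_congr_fun (Es_open _ _ _).measurableSet fun x hx => ?_
    rw [mem_Es] at hx
    rw [max_eq_left hx.1.le, div_eq_mul_inv]
  have E2 : ∫ x in ann y₂ s r', F x * (max ‖x - y₁‖ r')⁻¹ = ∫ x in ann y₂ s r', F x / ‖x - y₁‖ := by
    refine setIntegral_congr_fun (ann_meas _ _ _) fun x hx => ?_
    rw [mem_ann] at hx
    have := norm_sub_le (x - y₂) (x - y₁)
    rw [sub_sub_sub_cancel_left] at this
    rw [max_eq_left (by linarith [hx.2]), div_eq_mul_inv]
  have E3' : ∫ x in ann y₁ s r', F x * (max ‖x - y₁‖ r')⁻¹ = r'⁻¹ * ∫ x in ann y₁ s r', F x := by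
    rw [← integral_const_mul]
    refine setIntegral_congr_fun (ann_meas _ _ _) fun x hx => ?_
    rw [mem_ann] at hx
    rw [max_eq_right hx.2, mul_comm]
  have A1 := ann_est' y₁ hs₁ hs.1 hs.2.le F ia (Finset.range (K0+4)) (fun k : ℕ => -(k:ℝ)) (fun k : ℕ => c (-(k:ℝ))) (fun k _ => hcc _)
    r' hr'.le (by
      intro r hsr hrr n
      have hr : 0 < r := hs.1.trans hsr
      refine (hexp r hr (hrr.trans_lt hlt.1) n).trans ?_
      rw [← div_eq_mul_inv, one_le_div hr]
      exact hrr)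
  have A2 := ann_est' y₁ hs₁ hs.1 hs.2.le _ ia2 (Finset.range (K0+4)) (fun k : ℕ => -(k:ℝ) - 1) (fun k : ℕ => c (-(k:ℝ))) (fun k _ => hcc _)
    1 zero_le_one (by
      intro r hsr hrr n
      have hr : 0 < r := hs.1.trans hsr
      have := hexp r hr (hrr.trans_lt hlt.1) n
      rw [quot r hr n, abs_mul, abs_of_pos (inv_pos.2 hr), mul_comm]
      gcongr)
  rw [← D1 s] at A1
  rw [← D2 s] at A2
  have A1' : |r'⁻¹ * ((∫ x in ann y₁ s r', F x) + Dv c s₁ s - ∑ k ∈ Finset.range (K0+4), (TT s₁ r' (-(k:ℝ)) - smallT s (-(k:ℝ))) * ∫ n, c (-(k:ℝ)) n ∂dOmega)|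
      ≤ 2 * π * r' ^ 2 := by
    rw [abs_mul, abs_of_pos (inv_pos.2 hr')]
    calc _ ≤ r'⁻¹ * (r' * (2 * π * r' ^ 2)) := by gcongr
      _ = _ := by field_simp
  rw [pfApprox_eq]
  change |_ + _ + _ - ((∫ x in Es y₁ y₂ s, F x / ‖x - y₁‖) + _ + _) - _| ≤ _
  rw [sp1, sp2, E1, E2, E3']
  have SS : ∑ k ∈ Finset.range (K0 + 4), ((TT s₁ r' (-(k:ℝ)) - smallT s (-(k:ℝ))) * r'⁻¹ 
      - (TT s₁ r' (-(k:ℝ) - 1) - smallT s (-(k:ℝ) - 1))) * ∫ n, c (-(k:ℝ)) n ∂dOmega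
      = r'⁻¹ * (∑ k ∈ Finset.range (K0+4), (TT s₁ r' (-(k:ℝ)) - smallT s (-(k:ℝ))) * ∫ n, c (-(k:ℝ)) n ∂dOmega)
       - ∑ k ∈ Finset.range (K0+4), (TT s₁ r' (-(k:ℝ) - 1) - smallT s (-(k:ℝ) - 1)) * ∫ n, c (-(k:ℝ)) n ∂dOmega := by
    rw [Finset.mul_sum, ← Finset.sum_sub_distrib]
    exact Finset.sum_congr rfl fun k _ => by ring
  rw [SS]
  rw [abs_le] at A1' A2 ⊢
  rw [mul_sub, mul_add] at A1'
  constructor <;> linarith [A1'.1, A1'.2, A2.1, A2.2]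

lemma TT_sum {s₁ r' : ℝ} (hs₁ : 0 < s₁) (hr' : 0 < r') (K0 : ℕ) (h : ℕ → ℝ) :
    ∑ k ∈ Finset.range (K0 + 4), (TT s₁ r' (-(k:ℝ)) * r'⁻¹ - TT s₁ r' (-(k:ℝ) - 1)) * h k
      = (r' ^ 2 / 3 - r' ^ 2 / 2) * h 0 + (r' / 2 - r') * h 1 + (1 - Real.log (r' / s₁)) * h 2
        + ∑ j ∈ Finset.range (K0 + 1), ((if j = 0 then Real.log r' - Real.log s₁ else 0) + (-(1 / (j:ℝ)) + 1 / ((j:ℝ) + 1))) 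
           * h (j + 3) * r' ^ (-(j:ℤ) - 1) := by
  have e : K0 + 4 = 3 + (K0 + 1) := by ring
  rw [e, Finset.sum_range_add]
  congr 1
  · have r3 : r' ^ (3:ℝ) = r' ^ 3 := by exact_mod_cast Real.rpow_natCast r' 3
    have r2 : r' ^ (2:ℝ) = r' ^ 2 := by exact_mod_cast Real.rpow_natCast r' 2
    rw [Finset.sum_range_succ, Finset.sum_range_succ, Finset.sum_range_succ, Finset.sum_range_zero]
    unfold TT
    norm_num [r3, r2]
    field_simp
  · refine Finset.sum_congr rfl fun j _ => ?_
    have hz : r' ^ (-(j:ℤ) - 1) = r' ^ (-(j:ℝ) - 1) := by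
      rw [← Real.rpow_intCast]; push_cast; rfl
    have hz2 : r' ^ (-(j:ℝ)) * r'⁻¹ = r' ^ (-(j:ℝ) - 1) := by
      rw [Real.rpow_sub_one hr'.ne']; rfl
    rw [hz, add_comm 3 j]
    have hj : (0:ℝ) ≤ j := Nat.cast_nonneg j
    have t2 : TT s₁ r' (-((j+3 : ℕ):ℝ) - 1) = r' ^ (-(j:ℝ) - 1) * (-(1 / ((j:ℝ) + 1))) := by
      unfold TT
      push_cast
      rw [if_neg (by linarith)]
      have : -((j:ℝ) + 3) - 1 + 3 = -(j:ℝ) - 1 := by ring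
      rw [this]
      have h3 : -(j:ℝ) - 1 = -((j:ℝ) + 1) := by ring
      rw [div_eq_mul_inv, one_div, ← inv_neg, h3]
    rw [t2]
    have t1 : TT s₁ r' (-((j+3 : ℕ):ℝ)) * r'⁻¹ = ((if j = 0 then Real.log r' - Real.log s₁ else 0) + -(1 / (j:ℝ))) * r' ^ (-(j:ℝ) - 1) := by
      unfold TT
      by_cases hj0 : j = 0
      · subst hj0
        simp [Real.log_div hr'.ne' hs₁.ne', Real.rpow_neg_one]
      · have : (0:ℝ) < j := by exact_mod_cast Nat.pos_of_ne_zero hj0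
        push_cast
        rw [if_neg (by linarith), if_neg hj0, ← hz2]
        have h3 : -((j:ℝ) + 3) + 3 = -(j:ℝ) := by ring
        rw [h3, zero_add, one_div, ← inv_neg]
        ring
    rw [t1]
    ring


/-- partie finie of a Poisson integral at a singular point.  The
angular average of `P(y₁ + r'n')` admits, as `r' → 0⁺`, an expansion whose
`r'⁰`-part (including its `ln r'` term) is
`P(y₁) + [ln(r'/s₁) − 1](r₁²F)₁`, preceded by finitely many negative powers of
`r'` with possible `ln r'` coefficients. -/
theorem pf_of_poisson_integral_at_singularity
    (y₁ y₂ : E3) (hy : y₁ ≠ y₂) (s₁ s₂ : ℝ) (hs₁ : 0 < s₁) (hs₂ : 0 < s₂)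
    (F : E3 → ℝ) (c d : ℝ → S2 → ℝ) (hF : MemF y₁ y₂ F c d)
    (hci : IntegerExponents c) (hdi : IntegerExponents d)
    (η : ℝ) (hη : 0 < η)
    (hdecay : ∃ C R : ℝ, ∀ x : E3, R ≤ ‖x‖ → |F x| ≤ C * ‖x‖ ^ (-3 - η))
    -- the Poisson integral P(x') = −(1/4π) Pf ∫ F(x)/|x−x'| d³x, for x' ∉ {y₁,y₂}
    (P : E3 → ℝ)
    (hP : ∀ x' : E3, x' ≠ y₁ → x' ≠ y₂ →
      ∃ p q : ℝ → S2 → ℝ,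
        HasSingExpansion y₁ (fun x => F x / ‖x - x'‖) p
        ∧ HasSingExpansion y₂ (fun x => F x / ‖x - x'‖) q
        ∧ HasPfIntegral y₁ y₂ s₁ s₂ (fun x => F x / ‖x - x'‖) p q (-(4 * π) * P x'))
    -- the regularized value P(y₁) = −(1/4π) Pf ∫ F(x)/r₁ d³x
    (Py₁ : ℝ)
    (hPy₁ : ∃ p q : ℝ → S2 → ℝ,
        HasSingExpansion y₁ (fun x => F x / ‖x - y₁‖) p
        ∧ HasSingExpansion y₂ (fun x => F x / ‖x - y₁‖) q
        ∧ HasPfIntegral y₁ y₂ s₁ s₂ (fun x => F x / ‖x - y₁‖) p q (-(4 * π) * Py₁)) :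
    ∃ (m : ℕ) (ca da : ℕ → ℝ),
      Tendsto
        (fun r' : ℝ =>
          (4 * π)⁻¹ * (∫ n : S2, P (y₁ + r' • (n : E3)) ∂dOmega)
            - ((∑ k ∈ Finset.range m, (ca k + da k * Real.log r') * r' ^ (-(k : ℤ) - 1))
              + ((4 * π)⁻¹ * ∫ n : S2, c (-2) n ∂dOmega) * Real.log (r' / s₁)
              + (Py₁ - (4 * π)⁻¹ * ∫ n : S2, c (-2) n ∂dOmega)))
        (𝓝[>] (0 : ℝ)) (𝓝 0) := by
  have hI : ∀ s : ℝ, 0 < s → IntegrableOn F (Es y₁ y₂ s) := fun s hs =>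
    F_int hF.smooth.continuousOn hη hdecay hs
  obtain ⟨K0, δ, hδ, H⟩ := diff_est y₁ y₂ hy s₁ s₂ hs₁ hs₂ F c d hF hci hdi hI P hP Py₁ hPy₁
  set h : ℕ → ℝ := fun k => ∫ n, c (-(k:ℝ)) n ∂dOmega with hh
  have hc2 : ∫ n : S2, c (-2) n ∂dOmega = h 2 := by simp [hh]
  rw [hc2]
  refine ⟨K0 + 1, fun j => -(4 * π)⁻¹ * ((if j = 0 then - Real.log s₁ else 0) + (-(1 / (j:ℝ)) + 1 / ((j:ℝ) + 1))) * h (j + 3),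
    fun j => -(4 * π)⁻¹ * (if j = 0 then 1 else 0) * h (j + 3), ?_⟩
  have lim0 : Tendsto (fun r' : ℝ => r' ^ 2 + (4 * π)⁻¹ * (|(r' ^ 2 / 3 - r' ^ 2 / 2) * h 0| + |(r' / 2 - r') * h 1|)) (𝓝[>] 0) (𝓝 0) := by
    have hc : Continuous (fun r' : ℝ => r' ^ 2 + (4 * π)⁻¹ * (|(r' ^ 2 / 3 - r' ^ 2 / 2) * h 0| + |(r' / 2 - r') * h 1|)) := by fun_prop
    have := (hc.tendsto 0).mono_left (nhdsWithin_le_nhds (s := Set.Ioi 0))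
    simpa using this
  refine squeeze_zero_norm' ?_ lim0
  filter_upwards [Ioo_mem_nhdsGT hδ] with r' hr'
  have h1 := H r' hr'.1 hr'.2
  have h2 := TT_sum hs₁ hr'.1 K0 h
  simp only [hh] at h2
  rw [h2] at h1
  clear h2
  have h3 : ∑ j ∈ Finset.range (K0 + 1), (-(4 * π)⁻¹ * ((if j = 0 then - Real.log s₁ else 0) + (-(1 / (j:ℝ)) + 1 / ((j:ℝ) + 1))) * h (j + 3)
      + -(4 * π)⁻¹ * (if j = 0 then 1 else 0) * h (j + 3) * Real.log r') * r' ^ (-(j : ℤ) - 1)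
      = -(4 * π)⁻¹ * ∑ j ∈ Finset.range (K0 + 1), ((if j = 0 then Real.log r' - Real.log s₁ else 0) + (-(1 / (j:ℝ)) + 1 / ((j:ℝ) + 1))) 
           * h (j + 3) * r' ^ (-(j:ℤ) - 1) := by
    rw [Finset.mul_sum]
    refine Finset.sum_congr rfl fun j _ => ?_
    split_ifs <;> ring
  rw [h3]
  change |_ - (_ * h 0 + _ * h 1 + _ * h 2 + ∑ j ∈ Finset.range (K0 + 1), _ * h (j + 3) * _)| ≤ _ at h1
  generalize (∑ j ∈ Finset.range (K0 + 1), ((if j = 0 then Real.log r' - Real.log s₁ else 0) + (-(1 / (j:ℝ)) + 1 / ((j:ℝ) + 1))) 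
           * h (j + 3) * r' ^ (-(j:ℤ) - 1)) = Z at h1 ⊢
  generalize (∫ n : S2, P (y₁ + r' • (n : E3)) ∂dOmega) = X at h1 ⊢
  have hpi : 0 < 4 * π := by positivity
  rw [Real.norm_eq_abs]
  generalize (r' ^ 2 / 3 - r' ^ 2 / 2) * h 0 = a at h1 ⊢
  generalize (r' / 2 - r') * h 1 = b at h1 ⊢
  generalize Real.log (r' / s₁) = l at h1 ⊢
  have e : (4 * π)⁻¹ * X - (-(4 * π)⁻¹ * Z + (4 * π)⁻¹ * h 2 * l + (Py₁ - (4 * π)⁻¹ * h 2))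
      = (4 * π)⁻¹ * (-((-X - -(4 * π) * Py₁) - (a + b + (1 - l) * h 2 + Z)) - (a + b)) := by
    field_simp
    ring
  rw [e, abs_mul, abs_of_pos (inv_pos.2 hpi)]
  have h5 : |-((-X - -(4 * π) * Py₁) - (a + b + (1 - l) * h 2 + Z)) - (a + b)| ≤ 4 * π * r' ^ 2 + (|a| + |b|) := by
    refine (abs_sub _ _).trans ?_
    rw [abs_neg]
    exact add_le_add h1 (abs_add_le _ _)
  calc _ ≤ (4 * π)⁻¹ * (4 * π * r' ^ 2 + (|a| + |b|)) := by gcongr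
    _ = _ := by field_simp

end
end
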